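/- arXiv:math/0310429 — 2 statements merged into one kernel-verified Lean document; each statement's English description precedes it below -/
import Mathlib

section
/- There exists a rank-4 abstract polytope all of whose facets are isomorphic to the cube {4,3} and all of whose vertex figures are isomorphic to the hemioctahedron {3,4}₃, and any two such polytopes are isomorphic. -/
universe u v

/-- An abstract polytope of rank `n`: a bounded poset equipped with a rank function
taking values in `{-1, 0, ..., n}`, such that every maximal chain (flag) contains exactly
one face of each rank, satisfying the diamond condition and strong flag-connectivity. -/
structure APolytope (n : ℕ) : Type (u + 1) where
  /-- the type of faces -/
  α : Type u
  [po : PartialOrder α]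
  [bo : BoundedOrder α]
  /-- the rank function -/
  rank : α → ℤ
  rank_bot : rank ⊥ = -1
  rank_top : rank ⊤ = (n : ℤ)
  rank_strictMono : StrictMono rank
  rank_mem : ∀ F : α, rank F ∈ Set.Icc (-1 : ℤ) (n : ℤ)
  /-- every flag (maximal chain) contains exactly one face of each rank `-1, ..., n`
  (hence exactly `n + 2` faces) -/
  flag_ranks : ∀ c : Set α, IsMaxChain (· ≤ ·) c →
    ∀ i ∈ Set.Icc (-1 : ℤ) (n : ℤ), ∃! F, F ∈ c ∧ rank F = i
  /-- the diamond condition -/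
  diamond : ∀ F G : α, F < G → rank G = rank F + 2 →
    ∃ H₁ H₂ : α, H₁ ≠ H₂ ∧ ∀ H : α, (F < H ∧ H < G) ↔ (H = H₁ ∨ H = H₂)
  /-- strong flag-connectivity: any two flags `c`, `d` are joined by a sequence of
  flags, successive ones differing in exactly one face, all containing `c ∩ d` -/
  connected : ∀ c d : Set α, IsMaxChain (· ≤ ·) c → IsMaxChain (· ≤ ·) d →
    Relation.ReflTransGen
      (fun x y : Set α => IsMaxChain (· ≤ ·) y ∧ c ∩ d ⊆ y ∧
        (∃ F G : α, x \ y = {F} ∧ y \ x = {G})) c d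

attribute [instance] APolytope.po APolytope.bo

namespace APolytope

variable {n : ℕ}

/-- A flag of a polytope is a maximal chain. -/
def IsFlag (P : APolytope.{u} n) (c : Set P.α) : Prop := IsMaxChain (· ≤ ·) c

/-- Two polytopes are isomorphic when there is an order isomorphism between their
face posets. -/
def Iso (P : APolytope.{u} n) (Q : APolytope.{v} n) : Prop := Nonempty (P.α ≃o Q.α)

/-- All facets (sections below a rank `n-1` face, including the least face) of `P`
are isomorphic to the poset `β`. In rank 4, facets are the sections `F/F₋₁` with
`rank F = 3`. -/
def FacetsAre (P : APolytope.{u} 4) (β : Type*) [PartialOrder β] : Prop :=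
  ∀ F : P.α, P.rank F = 3 → Nonempty (↥(Set.Iic F) ≃o β)

/-- All vertex figures (sections above a rank `0` face, up to the greatest face) of `P`
are isomorphic to the poset `β`. -/
def VertexFiguresAre (P : APolytope.{u} 4) (β : Type*) [PartialOrder β] : Prop :=
  ∀ x : P.α, P.rank x = 0 → Nonempty (↥(Set.Ici x) ≃o β)

end APolytope

def CubePosetData : Finset (Finset (Fin 28)) :=
  {{0},
   {0, 1},
   {0, 2},
   {0, 1, 2, 3},
   {0, 4},
   {0, 5},
   {0, 4, 5, 6},
   {0, 1, 4, 7},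
   {0, 2, 5, 8},
   {0, 1, 2, 3, 4, 5, 6, 7, 8, 9},
   {0, 10},
   {0, 11},
   {0, 10, 11, 12},
   {0, 13},
   {0, 14},
   {0, 13, 14, 15},
   {0, 10, 13, 16},
   {0, 11, 14, 17},
   {0, 10, 11, 12, 13, 14, 15, 16, 17, 18},
   {0, 1, 10, 19},
   {0, 2, 11, 20},
   {0, 1, 2, 3, 10, 11, 12, 19, 20, 21},
   {0, 4, 13, 22},
   {0, 5, 14, 23},
   {0, 4, 5, 6, 13, 14, 15, 22, 23, 24},
   {0, 1, 4, 7, 10, 13, 16, 19, 22, 25},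
   {0, 2, 5, 8, 11, 14, 17, 20, 23, 26},
   {0, 1, 2, 3, 4, 5, 6, 7, 8, 9, 10, 11, 12, 13, 14, 15, 16, 17, 18, 19, 20, 21, 22, 23, 24, 25, 26, 27}}

abbrev CubePoset := {S : Finset (Fin 28) // S ∈ CubePosetData}

def HemicubePosetData : Finset (Finset (Fin 15)) :=
  {{0},
   {0, 1},
   {0, 2},
   {0, 1, 2, 3},
   {0, 4},
   {0, 5},
   {0, 4, 5, 6},
   {0, 1, 4, 7},
   {0, 2, 5, 8},
   {0, 1, 2, 3, 4, 5, 6, 7, 8, 9},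
   {0, 1, 5, 10},
   {0, 2, 4, 11},
   {0, 1, 2, 3, 4, 5, 6, 10, 11, 12},
   {0, 1, 2, 4, 5, 7, 8, 10, 11, 13},
   {0, 1, 2, 3, 4, 5, 6, 7, 8, 9, 10, 11, 12, 13, 14}}

abbrev HemicubePoset := {S : Finset (Fin 15) // S ∈ HemicubePosetData}

/-- The hemioctahedron is the order dual of the hemicube. -/
abbrev HemiOctaPoset := HemicubePosetᵒᵈ

section Generic

theorem nonempty_orderIso_of_reindex {ι α β : Type*} [PartialOrder α] [PartialOrder β]
    (f : ι → α) (g : ι → β) (hf : f.Surjective) (hg : g.Surjective)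
    (h : ∀ i j, f i ≤ f j ↔ g i ≤ g j) : Nonempty (α ≃o β) := by
  have hfg : ∀ i j, f i = f j ↔ g i = g j := fun i j => by
    simp only [le_antisymm_iff, h]
  have key : ∀ a, f (Function.surjInv hf a) = a := Function.surjInv_eq hf
  let e : α ↪o β := OrderEmbedding.ofMapLEIff (fun a => g (Function.surjInv hf a))
    (fun a b => by rw [← h, key, key])
  refine ⟨RelIso.ofSurjective e fun b => ?_⟩
  obtain ⟨i, rfl⟩ := hg b
  exact ⟨f i, (hfg _ _).1 (key _)⟩

variable {α : Type*} [PartialOrder α]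

theorem isMaxChain_of_ranks {rank : α → ℤ} (hmono : StrictMono rank) {c : Set α}
    (hc : IsChain (· ≤ ·) c) (hr : ∀ x, ∃ y ∈ c, rank y = rank x) : IsMaxChain (· ≤ ·) c := by
  refine ⟨hc, fun t ht hct => hct.antisymm fun z hz => ?_⟩
  obtain ⟨y, hy, hyz⟩ := hr z
  rcases ht.total (hct hy) hz with h | h
  · rcases h.eq_or_lt with h | h
    · exact h ▸ hy
    · exact absurd (hmono h) (by omega)
  · rcases h.eq_or_lt with h | h
    · exact h ▸ hy
    · exact absurd (hmono h) (by omega)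

theorem IsChain.eq_of_rank_eq {rank : α → ℤ} (hmono : StrictMono rank) {c : Set α}
    (hc : IsChain (· ≤ ·) c) {x y : α} (hx : x ∈ c) (hy : y ∈ c) (h : rank x = rank y) :
    x = y := by
  rcases hc.total hx hy with hxy | hxy <;> rcases hxy.eq_or_lt with e | l
  · exact e
  · exact absurd (hmono l) (by omega)
  · exact e.symm
  · exact absurd (hmono l) (by omega)

theorem IsChain.lt_of_rank_lt {rank : α → ℤ} (hmono : StrictMono rank) {c : Set α}
    (hc : IsChain (· ≤ ·) c) {x y : α} (hx : x ∈ c) (hy : y ∈ c) (h : rank x < rank y) :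
    x < y := by
  rcases hc.total hx hy with hxy | hxy
  · exact hxy.lt_of_ne (by rintro rfl; exact h.false)
  · exact absurd (hmono.monotone hxy) (by omega)

theorem IsMaxChain.mem_of_comparable {c : Set α} (hc : IsMaxChain (· ≤ ·) c) {z : α}
    (h : ∀ y ∈ c, z ≤ y ∨ y ≤ z) : z ∈ c := by
  have := hc.2 (hc.1.insert fun b hb _ => h b hb) (Set.subset_insert z c)
  exact this ▸ Set.mem_insert z c

variable [BoundedOrder α] [Finite α] {n : ℕ} {rank : α → ℤ}

theorem existsUnique_rank_of_isMaxChain (hmono : StrictMono rank) (hbot : rank ⊥ = -1)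
    (htop : rank ⊤ = n)
    (hdense : ∀ x y, x < y → rank x + 1 < rank y → ∃ z, x < z ∧ z < y)
    {c : Set α} (hc : IsMaxChain (· ≤ ·) c) {i : ℤ} (hi : i ∈ Set.Icc (-1 : ℤ) n) :
    ∃! F, F ∈ c ∧ rank F = i := by
  refine existsUnique_of_exists_of_unique ?_ fun x y hx hy =>
    hc.1.eq_of_rank_eq hmono hx.1 hy.1 (hx.2.trans hy.2.symm)
  by_contra! hne
  obtain ⟨x, ⟨hxc, hxi⟩, hx⟩ := Set.exists_max_image {x | x ∈ c ∧ rank x < i} rank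
    (Set.toFinite _) ⟨⊥, hc.bot_mem, lt_of_le_of_ne (hbot ▸ hi.1) (hne _ hc.bot_mem)⟩
  obtain ⟨y, ⟨hyc, hyi⟩, hy⟩ := Set.exists_min_image {x | x ∈ c ∧ i < rank x} rank
    (Set.toFinite _) ⟨⊤, hc.top_mem, lt_of_le_of_ne (htop ▸ hi.2) (hne _ hc.top_mem).symm⟩
  obtain ⟨z, hxz, hzy⟩ := hdense x y (hc.1.lt_of_rank_lt hmono hxc hyc (hxi.trans hyi)) (by omega)
  have hzc : z ∈ c := hc.mem_of_comparable fun w hw => by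
    rcases (hne w hw).lt_or_gt with h | h
    · right
      by_contra hwz
      have : x < w := by
        rcases hc.1.total hw hxc with h' | h'
        · exact absurd (h'.trans hxz.le) hwz
        · exact h'.lt_of_ne (by rintro rfl; exact hwz hxz.le)
      exact absurd (hx w ⟨hw, h⟩) (not_le.2 (hmono this))
    · left
      by_contra hwz
      have : w < y := by
        rcases hc.1.total hw hyc with h' | h'
        · exact h'.lt_of_ne (by rintro rfl; exact hwz hzy.le)
        · exact absurd (hzy.le.trans h') hwz
      exact absurd (hy w ⟨hw, h⟩) (not_le.2 (hmono this))
  rcases (hne z hzc).lt_or_gt with h | h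
  · exact absurd (hx z ⟨hzc, h⟩) (not_le.2 (hmono hxz))
  · exact absurd (hy z ⟨hzc, h⟩) (not_le.2 (hmono hzy))

/-- If all sections of rank at least two are connected, then any two flags are joined by a
sequence of flags through their common faces. -/
theorem flag_connected_of_section_connected (hmono : StrictMono rank) (hbot : rank ⊥ = -1)
    (htop : rank ⊤ = n)
    (hflag : ∀ c : Set α, IsMaxChain (· ≤ ·) c → ∀ i ∈ Set.Icc (-1 : ℤ) n,
      ∃! F, F ∈ c ∧ rank F = i)
    (hsec : ∀ x y, x < y → rank x + 3 ≤ rank y → ∀ a ∈ Set.Ioo x y, ∀ b ∈ Set.Ioo x y,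
      Relation.ReflTransGen (fun p q => q ∈ Set.Ioo x y ∧ (p ≤ q ∨ q ≤ p)) a b)
    {c d : Set α} (hc : IsMaxChain (· ≤ ·) c) (hd : IsMaxChain (· ≤ ·) d) {K : Set α}
    (hK : K ⊆ c ∩ d) :
    Relation.ReflTransGen
      (fun x y : Set α => IsMaxChain (· ≤ ·) y ∧ K ⊆ y ∧
        (∃ F G : α, x \ y = {F} ∧ y \ x = {G})) c d := by
  have hrange : ∀ x, rank x ∈ Set.Icc (-1 : ℤ) n := fun x =>
    ⟨hbot ▸ hmono.monotone bot_le, htop ▸ hmono.monotone le_top⟩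
  have hlt : ∀ s t : Set α, s ⊂ t → s.ncard < t.ncard := fun s t h => Set.ncard_lt_ncard h
  have hle : ∀ s : Set α, s.ncard ≤ Nat.card α := fun s => Set.ncard_le_card s
  induction hm : Nat.card α - (c ∩ d).ncard using Nat.strong_induction_on generalizing c d K with
  | _ m ih =>
  have step : ∀ {c' d' L : Set α}, IsMaxChain (· ≤ ·) c' → IsMaxChain (· ≤ ·) d' →
      c ∩ d ⊂ c' ∩ d' → L ⊆ c' ∩ d' → Relation.ReflTransGen
      (fun x y : Set α => IsMaxChain (· ≤ ·) y ∧ L ⊆ y ∧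
        (∃ F G : α, x \ y = {F} ∧ y \ x = {G})) c' d' := fun {c' d' L} hc' hd' h hL => by
    refine ih _ ?_ hc' hd' hL rfl
    have := hlt _ _ h
    have := hle (c' ∩ d')
    omega
  by_cases hcd : c ⊆ d
  · rw [hc.2 hd.1 hcd]
  obtain ⟨a₀, ha₀c, ha₀d⟩ := Set.not_subset.1 hcd
  obtain ⟨a, ⟨hac, had⟩, ha⟩ := Set.exists_min_image (c \ d) rank (Set.toFinite _)
    ⟨a₀, ha₀c, ha₀d⟩
  have hab : ⊥ < a := bot_lt_iff_ne_bot.2 (by rintro rfl; exact had hd.bot_mem)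
  have hra := hmono hab
  obtain ⟨x, ⟨hxc, hxa⟩, -⟩ := hflag c hc (rank a - 1) ⟨by omega, by have := (hrange a).2; omega⟩
  have hxd : x ∈ d := by
    by_contra h
    have := ha x ⟨hxc, h⟩
    omega
  have hxa' : x < a := hc.1.lt_of_rank_lt hmono hxc hac (by omega)
  obtain ⟨y, ⟨⟨hyc, hyd⟩, hya⟩, hy⟩ := Set.exists_min_image {y | y ∈ c ∩ d ∧ rank a < rank y} rank
    (Set.toFinite _) ⟨⊤, ⟨hc.top_mem, hd.top_mem⟩, hmono (lt_top_iff_ne_top.2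
      (by rintro rfl; exact had hd.top_mem))⟩
  have hay : a < y := hc.1.lt_of_rank_lt hmono hac hyc hya
  obtain ⟨b, ⟨hbd, hba⟩, -⟩ := hflag d hd (rank a) (hrange a)
  have hbc : b ∉ c := fun h => had (hc.1.eq_of_rank_eq hmono h hac hba ▸ hbd)
  have hxb : x < b := hd.1.lt_of_rank_lt hmono hxd hbd (by omega)
  have hby : b < y := hd.1.lt_of_rank_lt hmono hbd hyd (by omega)
  have hout : ∀ z ∈ c ∩ d, z ≤ x ∨ y ≤ z := fun z hz => by
    rcases lt_trichotomy (rank z) (rank a) with h | h | h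
    · left
      rcases hc.1.total hz.1 hxc with h' | h'
      · exact h'
      · rcases h'.eq_or_lt with e | l
        · exact e.ge
        · have := hmono l
          omega
    · exact absurd (hc.1.eq_of_rank_eq hmono hz.1 hac h ▸ hz.2) had
    · right
      have := hy z ⟨hz, h⟩
      rcases hc.1.total hyc hz.1 with h' | h'
      · exact h'
      · rcases h'.eq_or_lt with e | l
        · exact e.ge
        · have := hmono l
          omega
  by_cases hgap : rank x + 3 ≤ rank y
  · have main : ∀ p, Relation.ReflTransGen
        (fun p q => q ∈ Set.Ioo x y ∧ (p ≤ q ∨ q ≤ p)) a p →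
        ∀ d', IsMaxChain (· ≤ ·) d' → c ∩ d ⊆ d' → p ∈ d' → Relation.ReflTransGen
          (fun x y : Set α => IsMaxChain (· ≤ ·) y ∧ K ⊆ y ∧
            (∃ F G : α, x \ y = {F} ∧ y \ x = {G})) c d' := fun p hp => by
      have hins : ∀ {q : α} {f g : Set α}, q ∈ Set.Ioo x y → q ∈ f → q ∈ g → c ∩ d ⊆ f →
          c ∩ d ⊆ g → c ∩ d ⊂ f ∩ g := fun {q f g} hq hf hg hfs hgs =>
        (Set.ssubset_iff_of_subset (Set.subset_inter hfs hgs)).2 ⟨q, ⟨hf, hg⟩, fun h => by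
          rcases hout q h with h | h
          · exact absurd (h.trans_lt hq.1) (lt_irrefl _)
          · exact absurd (hq.2.trans_le h) (lt_irrefl _)⟩
      induction hp with
      | refl =>
        intro d' hd' hs hp
        exact step hc hd' (hins ⟨hxa', hay⟩ hac hp Set.inter_subset_left hs)
          (Set.subset_inter (hK.trans Set.inter_subset_left) (hK.trans hs))
      | @tail p q hap hpq ihp =>
        intro d' hd' hs hq
        have hpI : p ∈ Set.Ioo x y := by
          rcases hap.cases_tail with h | ⟨_, _, h⟩
          · exact h ▸ ⟨hxa', hay⟩
          · exact h.1
        have hcomp : ∀ r ∈ Set.Ioo x y, ∀ z ∈ c ∩ d, r ≤ z ∨ z ≤ r := fun r hr z hz =>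
          (hout z hz).symm.imp (hr.2.le.trans ·) (·.trans hr.1.le)
        have hch : IsChain (· ≤ ·) (insert p (insert q (c ∩ d))) := by
          refine ((hc.1.mono Set.inter_subset_left).insert fun z hz _ =>
            hcomp q hpq.1 z hz).insert fun z hz _ => ?_
          rcases hz with rfl | hz
          · exact hpq.2
          · exact hcomp p hpI z hz
        obtain ⟨f, hf, hsf⟩ := hch.exists_maxChain
        have hKf : c ∩ d ⊆ f := fun z hz => hsf (.inr (.inr hz))
        exact (ihp f hf hKf (hsf (.inl rfl))).trans
          (step hf hd' (hins hpq.1 (hsf (.inr (.inl rfl))) hq hKf hs)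
            (Set.subset_inter (hK.trans hKf) (hK.trans hs)))
    exact main b (hsec x y (hxa'.trans hay) hgap a ⟨hxa', hay⟩ b ⟨hxb, hby⟩) d hd
      Set.inter_subset_right hbd
  · have hne : a ≠ b := fun h => hbc (h ▸ hac)
    have hcmp : ∀ z ∈ c \ {a}, b ≤ z ∨ z ≤ b := fun z hz => by
      rcases lt_trichotomy (rank z) (rank a) with h | h | h
      · right
        rcases hc.1.total hz.1 hxc with h' | h'
        · exact h'.trans hxb.le
        · rcases h'.eq_or_lt with e | l
          · exact e ▸ hxb.le
          · have := hmono l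
            omega
      · exact absurd (hc.1.eq_of_rank_eq hmono hz.1 hac h) hz.2
      · left
        rcases hc.1.total hz.1 hyc with h' | h'
        · rcases h'.eq_or_lt with e | l
          · exact e ▸ hby.le
          · have := hmono l
            omega
        · exact hby.le.trans h'
    have hchain : IsMaxChain (· ≤ ·) (insert b (c \ {a})) := by
      refine isMaxChain_of_ranks hmono
        ((hc.1.mono Set.sdiff_subset).insert fun z hz _ => hcmp z hz) fun z => ?_
      obtain ⟨w, ⟨hw, hwz⟩, -⟩ := hflag c hc (rank z) (hrange z)
      by_cases hwa : w = a
      · exact ⟨b, .inl rfl, by rw [hba, ← hwa, hwz]⟩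
      · exact ⟨w, .inr ⟨hw, hwa⟩, hwz⟩
    have hsub : c ∩ d ⊆ insert b (c \ {a}) := fun z hz =>
      .inr ⟨hz.1, by rintro rfl; exact had hz.2⟩
    refine .head ⟨hchain, hK.trans hsub, a, b, ?_, ?_⟩ (step hchain hd ?_ ?_)
    · ext z
      simp only [Set.mem_sdiff, Set.mem_insert_iff, Set.mem_singleton_iff]
      constructor
      · rintro ⟨h1, h2⟩
        by_contra h3
        exact h2 (.inr ⟨h1, h3⟩)
      · rintro rfl
        exact ⟨hac, by simp [hne]⟩
    · ext z
      simp only [Set.mem_sdiff, Set.mem_insert_iff, Set.mem_singleton_iff]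
      constructor
      · rintro ⟨h1 | h1, h2⟩
        · exact h1
        · exact absurd h1.1 h2
      · rintro rfl
        exact ⟨.inl rfl, hbc⟩
    · exact (Set.ssubset_iff_of_subset (Set.subset_inter hsub Set.inter_subset_right)).2
        ⟨b, ⟨.inl rfl, hbd⟩, fun h => hbc h.1⟩
    · exact Set.subset_inter (hK.trans hsub) (hK.trans Set.inter_subset_right)

end Generic

section Models

/-- Incidence of the faces of the cube.  Face `0` is the least face; for `i ≠ 0` the ternary digits
of `i - 1` are the coordinates of the face, the digit `2` standing for a free coordinate. -/
def cubeLE (i j : ℕ) : Bool :=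
  i == 0 || (j != 0 && [1, 3, 9].all fun w =>
    (j - 1) / w % 3 == 2 || (i - 1) / w % 3 == (j - 1) / w % 3)

/-- The faces of the cube below a given one. -/
def cubeFace (j : Fin 28) : Finset (Fin 28) := Finset.univ.filter fun i => cubeLE i j

/-- Incidence of the faces of the hemicube: the vertices are `1, 2, 4, 5`, the edges are
`3, 6, 7, 8, 10, 11` and the squares are `9, 12, 13`.  The binary digits of the listed numbers
indicate the faces below a given one. -/
def hemicubeLE (i j : ℕ) : Bool :=
  [1, 3, 5, 15, 17, 33, 113, 147, 293, 1023, 1059, 2069, 7295, 11703, 32767].getD j 0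
    / 2 ^ i % 2 == 1

/-- The faces of the hemicube below a given one. -/
def hemicubeFace (j : Fin 15) : Finset (Fin 15) := Finset.univ.filter fun i => hemicubeLE i j

theorem cubeLE_refl : ∀ i : Fin 28, cubeLE i i := by decide +kernel

theorem cubeLE_trans {i j k : ℕ} (hij : cubeLE i j) (hjk : cubeLE j k) : cubeLE i k := by
  simp only [cubeLE, Bool.or_eq_true, beq_iff_eq, Bool.and_eq_true, bne_iff_ne, List.all_cons,
    List.all_nil, Bool.and_true] at *
  grind

theorem cubeFace_subset_iff {i j : Fin 28} : cubeFace i ⊆ cubeFace j ↔ cubeLE i j := by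
  simp only [cubeFace, Finset.subset_iff, Finset.mem_filter, Finset.mem_univ, true_and]
  exact ⟨fun h => h (cubeLE_refl i), fun h _ hk => cubeLE_trans hk h⟩

theorem cubeFace_mem : ∀ j, cubeFace j ∈ CubePosetData := by decide +kernel

theorem exists_cubeFace_eq {S : Finset (Fin 28)} (h : S ∈ CubePosetData) :
    ∃ j, cubeFace j = S := by
  suffices ∀ S ∈ CubePosetData, cubeFace (S.sup id) = S from ⟨_, this S h⟩
  simp only [CubePosetData, Finset.forall_mem_insert, Finset.mem_singleton, forall_eq]
  and_intros <;> decide +kernel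

theorem hemicubeLE_refl : ∀ i : Fin 15, hemicubeLE i i := by decide +kernel

theorem hemicubeLE_trans : ∀ i j k : Fin 15, hemicubeLE i j → hemicubeLE j k → hemicubeLE i k := by
  decide +kernel

theorem hemicubeFace_subset_iff {i j : Fin 15} :
    hemicubeFace i ⊆ hemicubeFace j ↔ hemicubeLE i j := by
  simp only [hemicubeFace, Finset.subset_iff, Finset.mem_filter, Finset.mem_univ, true_and]
  exact ⟨fun h => h (hemicubeLE_refl i), fun h _ hk => hemicubeLE_trans _ _ _ hk h⟩

theorem hemicubeFace_mem : ∀ j, hemicubeFace j ∈ HemicubePosetData := by decide +kernel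

theorem exists_hemicubeFace_eq {S : Finset (Fin 15)} (h : S ∈ HemicubePosetData) :
    ∃ j, hemicubeFace j = S := by
  suffices ∀ S ∈ HemicubePosetData, hemicubeFace (S.sup id) = S from ⟨_, this S h⟩
  simp only [HemicubePosetData, Finset.forall_mem_insert, Finset.mem_singleton, forall_eq]
  and_intros <;> decide +kernel

theorem nonempty_orderIso_cubePoset_iff {α : Type*} [PartialOrder α] {s : Set α} :
    Nonempty (s ≃o CubePoset) ↔ ∃ f : Fin 28 → α, (∀ i j, f i ≤ f j ↔ cubeLE i j) ∧
      ∀ x, x ∈ s ↔ ∃ i, f i = x := by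
  constructor
  · rintro ⟨φ⟩
    refine ⟨fun i => φ.symm ⟨cubeFace i, cubeFace_mem i⟩, fun i j => ?_, fun x => ⟨fun hx => ?_, ?_⟩⟩
    · rw [Subtype.coe_le_coe, φ.symm.le_iff_le, ← cubeFace_subset_iff]
      rfl
    · obtain ⟨j, hj⟩ := exists_cubeFace_eq (φ ⟨x, hx⟩).2
      refine ⟨j, congrArg Subtype.val (φ.symm_apply_eq.2 (Subtype.ext hj) : _ = (⟨x, hx⟩ : s))⟩
    · rintro ⟨i, rfl⟩
      exact Subtype.prop _
  · rintro ⟨f, hf, hs⟩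
    refine nonempty_orderIso_of_reindex (ι := Fin 28) (fun i => ⟨f i, (hs _).2 ⟨i, rfl⟩⟩)
      (fun i => ⟨cubeFace i, cubeFace_mem i⟩) ?_ ?_ fun i j => ?_
    · rintro ⟨x, hx⟩
      obtain ⟨i, hi⟩ := (hs x).1 hx
      exact ⟨i, Subtype.ext hi⟩
    · rintro ⟨S, hS⟩
      obtain ⟨i, hi⟩ := exists_cubeFace_eq hS
      exact ⟨i, Subtype.ext hi⟩
    · exact (hf i j).trans cubeFace_subset_iff.symm

theorem nonempty_orderIso_hemiOctaPoset_iff {α : Type*} [PartialOrder α] {s : Set α} :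
    Nonempty (s ≃o HemiOctaPoset) ↔ ∃ f : Fin 15 → α, (∀ i j, f i ≤ f j ↔ hemicubeLE j i) ∧
      ∀ x, x ∈ s ↔ ∃ i, f i = x := by
  constructor
  · rintro ⟨φ⟩
    refine ⟨fun i => φ.symm (OrderDual.toDual ⟨hemicubeFace i, hemicubeFace_mem i⟩),
      fun i j => ?_, fun x => ⟨fun hx => ?_, ?_⟩⟩
    · rw [Subtype.coe_le_coe, φ.symm.le_iff_le, ← hemicubeFace_subset_iff]
      rfl
    · obtain ⟨j, hj⟩ := exists_hemicubeFace_eq (OrderDual.ofDual (φ ⟨x, hx⟩)).2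
      refine ⟨j, congrArg Subtype.val (φ.symm_apply_eq.2 (Subtype.ext hj) : _ = (⟨x, hx⟩ : s))⟩
    · rintro ⟨i, rfl⟩
      exact Subtype.prop _
  · rintro ⟨f, hf, hs⟩
    refine nonempty_orderIso_of_reindex (ι := Fin 15) (fun i => ⟨f i, (hs _).2 ⟨i, rfl⟩⟩)
      (fun i => OrderDual.toDual ⟨hemicubeFace i, hemicubeFace_mem i⟩) ?_ ?_ fun i j => ?_
    · rintro ⟨x, hx⟩
      obtain ⟨i, hi⟩ := (hs x).1 hx
      exact ⟨i, Subtype.ext hi⟩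
    · intro S
      obtain ⟨i, hi⟩ := exists_hemicubeFace_eq (OrderDual.ofDual S).2
      exact ⟨i, Subtype.ext hi⟩
    · exact (hf i j).trans hemicubeFace_subset_iff.symm

end Models

section Existence

/-- The vertices below the `x`-th face of the polytope, as (the index of) a face of the cube. -/
def faceShape (x : ℕ) : ℕ :=
  [0, 1, 2, 3, 4, 5, 6, 7, 8, 9, 10, 11, 12, 13, 14, 15, 16, 17, 18, 19, 20, 21, 22, 23, 24, 25, 26,
    27, 25, 26, 21, 24, 9, 18, 27, 27, 27, 27].getD x 0

/-- The facets above the `x`-th face of the polytope, as a binary number. -/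
def faceCells (x : ℕ) : ℕ :=
  [15, 15, 15, 15, 15, 15, 15, 15, 15, 9, 15, 15, 15, 15, 15, 15, 15, 15, 9, 15, 15, 5, 15, 15, 5,
    3, 3, 1, 12, 12, 10, 10, 6, 6, 2, 4, 8, 0].getD x 0

/-- Incidence of the faces of the polytope. -/
def faceLE (x y : ℕ) : Bool :=
  cubeLE (faceShape x) (faceShape y) && faceCells y &&& faceCells x == faceCells y

/-- The rank, increased by one, of the `x`-th face of the polytope. -/
def faceHeight (x : ℕ) : ℕ :=
  [0, 1, 1, 2, 1, 1, 2, 2, 2, 3, 1, 1, 2, 1, 1, 2, 2, 2, 3, 2, 2, 3, 2, 2, 3, 3, 3, 4, 3, 3, 3, 3,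
    3, 3, 4, 4, 4, 5].getD x 0

/-- The faces strictly between the `x`-th and the `y`-th face. -/
def faceBetween (x y : ℕ) : List ℕ :=
  (List.range 38).filter fun z => faceLE x z && faceLE z y && z != x && z != y

theorem faceLE_refl : ∀ x < 38, faceLE x x := by decide +kernel

theorem faceLE_trans {x y z : ℕ} (hxy : faceLE x y) (hyz : faceLE y z) : faceLE x z := by
  simp only [faceLE, Bool.and_eq_true, beq_iff_eq] at *
  exact ⟨cubeLE_trans hxy.1 hyz.1, by rw [← hyz.2, Nat.land_assoc, hxy.2]⟩

theorem bot_faceLE : ∀ x < 38, faceLE 0 x := by decide +kernel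

theorem faceLE_top : ∀ x < 38, faceLE x 37 := by decide +kernel

theorem faceHeight_lt : ∀ x < 38, ∀ y < 38, faceLE x y → x ≠ y → faceHeight x < faceHeight y := by
  decide +kernel

theorem length_faceBetween : ∀ x < 38, ∀ y < 38, faceHeight y = faceHeight x + 2 → faceLE x y →
    (faceBetween x y).length = 2 := by
  decide +kernel

theorem faceBetween_ne_nil : ∀ x < 38, ∀ y < 38, faceHeight x + 1 < faceHeight y → faceLE x y →
    (faceBetween x y) ≠ [] := by
  decide +kernel

set_option synthInstance.maxHeartbeats 200000 in
set_option synthInstance.maxSize 1000 in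
theorem exists_atom : ∀ x < 38, ∀ y < 38, faceHeight x + 3 ≤ faceHeight y → faceLE x y →
    ∀ a ∈ faceBetween x y, ∃ b ∈ faceBetween x y, faceHeight b = faceHeight x + 1 ∧ faceLE b a := by
  decide +kernel

set_option synthInstance.maxHeartbeats 200000 in
set_option synthInstance.maxSize 1000 in
theorem atoms_connected : ∀ x < 38, ∀ y < 38, faceHeight x + 3 ≤ faceHeight y → faceLE x y →
    ∀ a ∈ faceBetween x y, faceHeight a = faceHeight x + 1 →
    ∀ b ∈ faceBetween x y, faceHeight b = faceHeight x + 1 →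
    ∃ c ∈ faceBetween x y, (∃ z ∈ faceBetween x y, faceLE a z ∧ faceLE c z) ∧
      ∃ z ∈ faceBetween x y, faceLE c z ∧ faceLE b z := by
  decide +kernel

theorem mem_faceBetween {x y z : ℕ} : z ∈ faceBetween x y ↔
    z < 38 ∧ (faceLE x z ∧ x ≠ z) ∧ faceLE z y ∧ z ≠ y := by
  simp only [faceBetween, List.mem_filter, List.mem_range, Bool.and_eq_true, bne_iff_ne,
    ne_comm (a := x)]
  tauto

/-- The faces of the polytope `{{4,3},{3,4}₃}`. -/
@[ext] structure CellFace : Type u where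
  /-- the index of the face -/
  idx : Fin 38

namespace CellFace

instance : PartialOrder CellFace.{u} where
  le x y := faceLE x.idx y.idx
  le_refl x := faceLE_refl _ x.idx.2
  le_trans _ _ _ := faceLE_trans
  le_antisymm x y hxy hyx := by
    by_contra h
    have h' : x.idx.val ≠ y.idx.val := fun e => h (CellFace.ext (Fin.ext e))
    exact lt_asymm (faceHeight_lt _ x.idx.2 _ y.idx.2 hxy h')
      (faceHeight_lt _ y.idx.2 _ x.idx.2 hyx h'.symm)

theorem le_def {x y : CellFace.{u}} : x ≤ y ↔ faceLE x.idx y.idx := Iff.rfl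

theorem lt_def {x y : CellFace.{u}} : x < y ↔ faceLE x.idx y.idx ∧ x.idx.val ≠ y.idx.val := by
  rw [lt_iff_le_and_ne, le_def, ne_eq, CellFace.ext_iff, Fin.ext_iff]

instance : BoundedOrder CellFace.{u} where
  bot := ⟨0⟩
  bot_le x := bot_faceLE _ x.idx.2
  top := ⟨37⟩
  le_top x := faceLE_top _ x.idx.2

instance : Finite CellFace.{u} :=
  Finite.of_injective CellFace.idx fun _ _ => CellFace.ext

/-- The rank of a face. -/
def rank (x : CellFace.{u}) : ℤ := faceHeight x.idx - 1

theorem rank_strictMono : StrictMono rank.{u} := fun x y h => by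
  have := faceHeight_lt _ x.idx.2 _ y.idx.2 (lt_def.1 h).1 (lt_def.1 h).2
  unfold rank
  omega

theorem mem_faceBetween_iff {x y z : CellFace.{u}} :
    z.idx.val ∈ faceBetween x.idx y.idx ↔ x < z ∧ z < y := by
  rw [mem_faceBetween, lt_def, lt_def, and_iff_right z.idx.2]

theorem exists_of_mem {x y : CellFace.{u}} {m : ℕ} (h : m ∈ faceBetween x.idx y.idx) :
    ∃ z : CellFace.{u}, z.idx.val = m ∧ x < z ∧ z < y :=
  ⟨⟨m, (mem_faceBetween.1 h).1⟩, rfl, mem_faceBetween_iff.1 h⟩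

theorem exists_flag_ranks {c : Set CellFace.{u}} (hc : IsMaxChain (· ≤ ·) c) {i : ℤ}
    (hi : i ∈ Set.Icc (-1 : ℤ) (4 : ℕ)) : ∃! F, F ∈ c ∧ rank F = i := by
  refine existsUnique_rank_of_isMaxChain rank_strictMono rfl rfl (fun x y hxy hr => ?_) hc hi
  obtain ⟨m, hm⟩ := List.exists_mem_of_ne_nil _ (faceBetween_ne_nil _ x.idx.2 _ y.idx.2
    (by unfold rank at hr; omega) hxy.le)
  obtain ⟨z, -, hz⟩ := exists_of_mem hm
  exact ⟨z, hz⟩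

theorem diamond {x y : CellFace.{u}} (hxy : x < y) (hr : rank y = rank x + 2) :
    ∃ z w : CellFace.{u}, z ≠ w ∧ ∀ t, (x < t ∧ t < y) ↔ (t = z ∨ t = w) := by
  obtain ⟨a, b, hab⟩ := List.length_eq_two.1 (length_faceBetween _ x.idx.2 _ y.idx.2
    (by unfold rank at hr; omega) hxy.le)
  have hnd : (faceBetween x.idx y.idx).Nodup := List.nodup_range.filter _
  obtain ⟨z, rfl, -⟩ := exists_of_mem (x := x) (y := y) (m := a) (by simp [hab])
  obtain ⟨w, rfl, -⟩ := exists_of_mem (x := x) (y := y) (m := b) (by simp [hab])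
  refine ⟨z, w, ?_, fun t => ?_⟩
  · rintro rfl
    simp [hab] at hnd
  · rw [← mem_faceBetween_iff, hab]
    simp [CellFace.ext_iff, Fin.ext_iff]

theorem section_connected {x y : CellFace.{u}} (hxy : x < y) (hr : rank x + 3 ≤ rank y)
    {a b : CellFace.{u}} (ha : a ∈ Set.Ioo x y) (hb : b ∈ Set.Ioo x y) :
    Relation.ReflTransGen (fun p q => q ∈ Set.Ioo x y ∧ (p ≤ q ∨ q ≤ p)) a b := by
  have hr' : faceHeight x.idx + 3 ≤ faceHeight y.idx := by unfold rank at hr; omega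
  obtain ⟨_, ha₁, ha₂, ha₃⟩ := exists_atom _ x.idx.2 _ y.idx.2 hr' hxy.le _ (mem_faceBetween_iff.2 ha)
  obtain ⟨_, hb₁, hb₂, hb₃⟩ := exists_atom _ x.idx.2 _ y.idx.2 hr' hxy.le _ (mem_faceBetween_iff.2 hb)
  obtain ⟨_, hc₁, ⟨_, hz₁, haz, hcz⟩, _, hw₁, hcw, hbw⟩ :=
    atoms_connected _ x.idx.2 _ y.idx.2 hr' hxy.le _ ha₁ ha₂ _ hb₁ hb₂
  obtain ⟨a', rfl, ha'⟩ := exists_of_mem ha₁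
  obtain ⟨b', rfl, hb'⟩ := exists_of_mem hb₁
  obtain ⟨c, rfl, hc⟩ := exists_of_mem hc₁
  obtain ⟨z, rfl, hz⟩ := exists_of_mem hz₁
  obtain ⟨w, rfl, hw⟩ := exists_of_mem hw₁
  exact .head ⟨ha', .inr ha₃⟩ <| .head ⟨hz, .inl haz⟩ <| .head ⟨hc, .inr hcz⟩ <|
    .head ⟨hw, .inl hcw⟩ <| .head ⟨hb', .inr hbw⟩ <| .single ⟨hb, .inl hb₃⟩

end CellFace

/-- The universal polytope `{{4,3},{3,4}₃}`. -/
def cellPolytope : APolytope.{u} 4 where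
  α := CellFace
  rank := CellFace.rank
  rank_bot := rfl
  rank_top := rfl
  rank_strictMono := CellFace.rank_strictMono
  rank_mem x := ⟨CellFace.rank_strictMono.monotone (bot_le (a := x)),
    CellFace.rank_strictMono.monotone (le_top (a := x))⟩
  flag_ranks _ hc _ hi := CellFace.exists_flag_ranks hc hi
  diamond _ _ := CellFace.diamond
  connected _ _ hc hd := flag_connected_of_section_connected (n := 4) CellFace.rank_strictMono rfl
    rfl (fun _ hc _ hi => CellFace.exists_flag_ranks hc hi)
    (fun _ _ hxy hr _ ha _ hb => CellFace.section_connected hxy hr ha hb) hc hd subset_rfl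

/-- The faces of the four facets, indexed by the faces of the cube. -/
def cellFacet (F : ℕ) (i : Fin 28) : Fin 38 :=
  ((List.finRange 38).find? fun x : Fin 38 => faceShape x.val == i.val && faceLE x.val F).getD 0

/-- The faces above the eight vertices, indexed by the faces of the hemicube. -/
def cellVertexFigure (v : ℕ) : List (Fin 38) :=
  match v with
  | 1 => [37, 27, 34, 25, 35, 36, 28, 21, 30, 19, 9, 32, 7, 3, 1]
  | 2 => [37, 27, 34, 26, 35, 36, 29, 21, 30, 20, 9, 32, 8, 3, 2]
  | 4 => [37, 27, 34, 25, 35, 36, 28, 24, 31, 22, 9, 32, 7, 6, 4]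
  | 5 => [37, 27, 34, 26, 35, 36, 29, 24, 31, 23, 9, 32, 8, 6, 5]
  | 10 => [37, 27, 34, 25, 35, 36, 28, 21, 30, 19, 18, 33, 16, 12, 10]
  | 11 => [37, 27, 34, 26, 35, 36, 29, 21, 30, 20, 18, 33, 17, 12, 11]
  | 13 => [37, 27, 34, 25, 35, 36, 28, 24, 31, 22, 18, 33, 16, 15, 13]
  | _ => [37, 27, 34, 26, 35, 36, 29, 24, 31, 23, 18, 33, 17, 15, 14]

theorem cellFacet_le_iff : ∀ F < 38, faceHeight F = 4 → ∀ i j : Fin 28,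
    faceLE (cellFacet F i) (cellFacet F j) = cubeLE i j := by decide +kernel

theorem mem_cellFacet_iff : ∀ F < 38, faceHeight F = 4 → ∀ x : Fin 38,
    faceLE x F ↔ ∃ i, cellFacet F i = x := by decide +kernel

theorem cellVertexFigure_le_iff : ∀ v < 38, faceHeight v = 1 → ∀ i j : Fin 15,
    faceLE ((cellVertexFigure v).getD i 0) ((cellVertexFigure v).getD j 0) = hemicubeLE j i := by
  decide +kernel

theorem mem_cellVertexFigure_iff : ∀ v < 38, faceHeight v = 1 → ∀ x : Fin 38,
    faceLE v x ↔ ∃ i : Fin 15, (cellVertexFigure v).getD i 0 = x := by decide +kernel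

theorem cellPolytope_facetsAre : cellPolytope.{u}.FacetsAre CubePoset := by
  intro (F : CellFace) (hF : F.rank = 3)
  have hF : faceHeight F.idx = 4 := by unfold CellFace.rank at hF; omega
  refine nonempty_orderIso_cubePoset_iff.2 ⟨fun i => CellFace.mk (cellFacet F.idx i),
    fun i j => ?_, fun (x : CellFace) => ?_⟩
  · rw [← cellFacet_le_iff _ F.idx.2 hF]
    rfl
  · refine (mem_cellFacet_iff _ F.idx.2 hF x.idx).trans (exists_congr fun i => ?_)
    exact CellFace.ext_iff (x := ⟨_⟩).symm

theorem cellPolytope_vertexFiguresAre : cellPolytope.{u}.VertexFiguresAre HemiOctaPoset := by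
  intro (v : CellFace) (hv : v.rank = 0)
  have hv : faceHeight v.idx = 1 := by unfold CellFace.rank at hv; omega
  refine nonempty_orderIso_hemiOctaPoset_iff.2
    ⟨fun i => CellFace.mk ((cellVertexFigure v.idx).getD i 0), fun i j => ?_,
      fun (x : CellFace) => ?_⟩
  · rw [← cellVertexFigure_le_iff _ v.idx.2 hv]
    rfl
  · refine (mem_cellVertexFigure_iff _ v.idx.2 hv x.idx).trans (exists_congr fun i => ?_)
    exact CellFace.ext_iff (x := ⟨_⟩).symm

end Existence

section CubeFaces

/-- The rank, increased by one, of the `j`-th face of the cube. -/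
def cubeHeight (j : ℕ) : ℕ :=
  if j = 0 then 0 else 1 + [1, 3, 9].countP fun w => (j - 1) / w % 3 == 2

/-- The rank, increased by one, of the `j`-th face of the hemicube. -/
def hemicubeHeight (j : ℕ) : ℕ := [0, 1, 1, 2, 1, 1, 2, 2, 2, 3, 2, 2, 3, 3, 4].getD j 0

/-- The `i`-th coordinate of a vertex of the cube. -/
def cubeCoord (k : Fin 8) (i : Fin 3) : Bool := Nat.testBit k i

/-- The vertex of the cube which differs from `k` in the `i`-th coordinate only. -/
def cubeFlip (k : Fin 8) (i : Fin 3) : Fin 8 := Fin.ofNat 8 (k ^^^ 2 ^ i.val)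

/-- The index of a vertex among the faces of the cube. -/
def vertexIdx (k : Fin 8) : Fin 28 := Fin.ofNat 28 (1 + k % 2 + 3 * (k / 2 % 2) + 9 * (k / 4))

theorem exists_cubeHeight_pred : ∀ i : Fin 28, cubeHeight i ≠ 0 →
    ∃ j : Fin 28, (cubeLE j i ∧ ¬ cubeLE i j) ∧ cubeHeight j + 1 = cubeHeight i := by
  decide +kernel

theorem exists_cubeHeight_succ : ∀ i : Fin 28, 4 - cubeHeight i ≠ 0 →
    ∃ j : Fin 28, (cubeLE i j ∧ ¬ cubeLE j i) ∧ 4 - cubeHeight j + 1 = 4 - cubeHeight i := by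
  decide +kernel

theorem exists_hemicubeHeight_pred : ∀ i : Fin 15, hemicubeHeight i ≠ 0 →
    ∃ j : Fin 15, (hemicubeLE j i ∧ ¬ hemicubeLE i j) ∧
      hemicubeHeight j + 1 = hemicubeHeight i := by
  decide +kernel

theorem exists_hemicubeHeight_succ : ∀ i : Fin 15, 4 - hemicubeHeight i ≠ 0 →
    ∃ j : Fin 15, (hemicubeLE i j ∧ ¬ hemicubeLE j i) ∧
      4 - hemicubeHeight j + 1 = 4 - hemicubeHeight i := by
  decide +kernel

theorem add_height_le {ι : Type*} {lt : ι → ι → Prop} {r : ι → ℤ} {h : ι → ℕ} {m : ℤ}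
    (hr : ∀ i j, lt i j → r i < r j) (hstep : ∀ i, h i ≠ 0 → ∃ j, lt j i ∧ h j + 1 = h i)
    (h0 : ∀ i, h i = 0 → m ≤ r i) (i : ι) : m + h i ≤ r i := by
  induction hn : h i generalizing i with
  | zero => simpa using h0 i hn
  | succ n ih =>
    obtain ⟨j, hji, hj⟩ := hstep i (by omega)
    have := ih j (by omega)
    have := hr _ _ hji
    push_cast
    omega

theorem cubeFlip_cubeFlip : ∀ k i, cubeFlip (cubeFlip k i) i = k := by decide +kernel

theorem cubeFlip_ne : ∀ k i, cubeFlip k i ≠ k := by decide +kernel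

theorem cubeHeight_vertexIdx : ∀ k, cubeHeight (vertexIdx k) = 1 := by decide +kernel

theorem cubeLE_vertexIdx : ∀ k l, cubeLE (vertexIdx k) (vertexIdx l) → k = l := by decide +kernel

theorem exists_vertexIdx_eq : ∀ j : Fin 28, cubeHeight j = 1 → ∃ k, vertexIdx k = j := by
  decide +kernel

theorem exists_cube_edge : ∀ k i, ∃ j : Fin 28, cubeHeight j = 2 ∧
    ∀ m, cubeLE (vertexIdx m) j ↔ m = k ∨ m = cubeFlip k i := by
  decide +kernel

theorem cube_edge : ∀ j : Fin 28, cubeHeight j = 2 →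
    ∃ k i, ∀ m, cubeLE (vertexIdx m) j ↔ m = k ∨ m = cubeFlip k i := by
  decide +kernel

theorem exists_cube_square : ∀ i a, ∃ j : Fin 28, cubeHeight j = 3 ∧
    ∀ m, cubeLE (vertexIdx m) j ↔ cubeCoord m i = a := by
  decide +kernel

theorem cube_square : ∀ j : Fin 28, cubeHeight j = 3 →
    ∃ i a, ∀ m, cubeLE (vertexIdx m) j ↔ cubeCoord m i = a := by
  decide +kernel

theorem cubeLE_of_vertexIdx : ∀ i j : Fin 28,
    (∀ m, cubeLE (vertexIdx m) i → cubeLE (vertexIdx m) j) → cubeLE i j := by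
  decide +kernel

theorem exists_four_cycle : ∀ i a, ∃ k j l, (cubeFlip (cubeFlip (cubeFlip (cubeFlip k j) l) j) l = k
    ∧ cubeFlip (cubeFlip k j) l ≠ k ∧ cubeFlip (cubeFlip (cubeFlip k j) l) j ≠ cubeFlip k j) ∧
    ∀ m, cubeCoord m i = a ↔ m = k ∨ m = cubeFlip k j ∨ m = cubeFlip (cubeFlip k j) l ∨
      m = cubeFlip (cubeFlip (cubeFlip k j) l) j := by
  decide +kernel

theorem four_cycle : ∀ k i₁ i₂ i₃ i₄,
    cubeFlip (cubeFlip (cubeFlip (cubeFlip k i₁) i₂) i₃) i₄ = k →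
    cubeFlip (cubeFlip k i₁) i₂ ≠ k →
    cubeFlip (cubeFlip (cubeFlip k i₁) i₂) i₃ ≠ cubeFlip k i₁ →
    ∃ i a, ∀ m, cubeCoord m i = a ↔ m = k ∨ m = cubeFlip k i₁ ∨ m = cubeFlip (cubeFlip k i₁) i₂ ∨
      m = cubeFlip (cubeFlip (cubeFlip k i₁) i₂) i₃ := by
  decide +kernel

/-- Automorphisms of the graph of the cube permute its squares. -/
theorem exists_square_image (σ : Fin 8 → Fin 8) (hinj : σ.Injective)
    (hσ : ∀ k i, ∃ j, σ (cubeFlip k i) = cubeFlip (σ k) j) (i : Fin 3) (a : Bool) :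
    ∃ i' a', ∀ k, cubeCoord k i = a ↔ cubeCoord (σ k) i' = a' := by
  obtain ⟨k, j, l, ⟨hk, hk₁, hk₂⟩, h⟩ := exists_four_cycle i a
  obtain ⟨i₁, h₁⟩ := hσ k j
  obtain ⟨i₂, h₂⟩ := hσ (cubeFlip k j) l
  obtain ⟨i₃, h₃⟩ := hσ (cubeFlip (cubeFlip k j) l) j
  obtain ⟨i₄, h₄⟩ := hσ (cubeFlip (cubeFlip (cubeFlip k j) l) j) l
  have hk' := congrArg σ hk
  have hk₁' := hinj.ne hk₁
  have hk₂' := hinj.ne hk₂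
  rw [h₁] at h₂
  rw [h₂] at h₃
  rw [h₃] at h₄
  rw [h₄] at hk'
  rw [h₂] at hk₁'
  rw [h₃, h₁] at hk₂'
  obtain ⟨i', a', h'⟩ := four_cycle _ _ _ _ _ hk' hk₁' hk₂'
  refine ⟨i', a', fun m => ?_⟩
  rw [h, h', ← h₃, ← h₂, ← h₁, hinj.eq_iff, hinj.eq_iff, hinj.eq_iff, hinj.eq_iff]

/-- If a family of squares covers every vertex once, then it consists of two opposite squares. -/
theorem exists_axis : ∀ b : Bool → Fin 3 → Bool,
    (∀ k, ∃ j, b (cubeCoord k j) j ∧ ∀ l, b (cubeCoord k l) l → l = j) →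
    ∃ i, ∀ a j, b a j ↔ j = i := by
  decide +kernel

theorem hemicube_edge_cell : ∀ i j : Fin 15, hemicubeHeight i = 1 → hemicubeHeight j = 3 →
    hemicubeLE i j := by
  decide +kernel

theorem hemicube_common : ∀ i j : Fin 15, hemicubeHeight i = 1 → hemicubeHeight j = 1 → i ≠ j →
    ∃ z : Fin 15, (hemicubeHeight z = 2 ∧ hemicubeLE i z ∧ hemicubeLE j z) ∧
      ∀ w : Fin 15, hemicubeHeight w = 2 → hemicubeLE i w → hemicubeLE j w → w = z := by
  decide +kernel

theorem cubeCoord_eq_iff_injective : ∀ i j a b,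
    (∀ m, cubeCoord m i = a ↔ cubeCoord m j = b) → i = j := by
  decide +kernel

theorem succ_xor_succ : ∀ i j k : Fin 3, i ≠ j → i ≠ k → j ≠ k → i.succ = j.succ ^^^ k.succ := by
  decide +kernel

theorem succ_eq_xor_iff : ∀ (i : Fin 3) (c d : Fin 4), i.succ = c ^^^ d ↔ d = c ^^^ i.succ := by
  decide +kernel

theorem xor_succ_ne : ∀ (i : Fin 3) (c : Fin 4), c ≠ c ^^^ i.succ := by decide +kernel

end CubeFaces

namespace APolytope

section

variable {n : ℕ} {P : APolytope.{u} n}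

theorem exists_isMaxChain_mem {x y : P.α} (hxy : x ≤ y) :
    ∃ c : Set P.α, IsMaxChain (· ≤ ·) c ∧ x ∈ c ∧ y ∈ c := by
  obtain ⟨c, hc, hs⟩ := (IsChain.pair (r := (· ≤ ·)) hxy).exists_maxChain
  exact ⟨c, hc, hs (by simp), hs (by simp)⟩

theorem exists_rank_eq {x y : P.α} (hxy : x ≤ y) {i : ℤ} (hx : P.rank x ≤ i) (hy : i ≤ P.rank y) :
    ∃ z, x ≤ z ∧ z ≤ y ∧ P.rank z = i := by
  obtain ⟨c, hc, hxc, hyc⟩ := exists_isMaxChain_mem hxy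
  obtain ⟨z, ⟨hz, hzi⟩, -⟩ :=
    P.flag_ranks c hc i ⟨(P.rank_mem x).1.trans hx, hy.trans (P.rank_mem y).2⟩
  refine ⟨z, ?_, ?_, hzi⟩
  · rcases (hzi ▸ hx).eq_or_lt with h | h
    · exact (hc.1.eq_of_rank_eq P.rank_strictMono hxc hz h).le
    · exact (hc.1.lt_of_rank_lt P.rank_strictMono hxc hz h).le
  · rcases (hzi ▸ hy).eq_or_lt with h | h
    · exact (hc.1.eq_of_rank_eq P.rank_strictMono hz hyc h).le
    · exact (hc.1.lt_of_rank_lt P.rank_strictMono hz hyc h).le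

theorem eq_of_le_of_rank_le {x y : P.α} (hxy : x ≤ y) (h : P.rank y ≤ P.rank x) : x = y := by
  rcases hxy.eq_or_lt with e | l
  · exact e
  · exact absurd (P.rank_strictMono l) (by omega)

theorem eq_bot_of_rank {x : P.α} (h : P.rank x = -1) : x = ⊥ :=
  (eq_of_le_of_rank_le bot_le (by rw [h, P.rank_bot])).symm

theorem eq_top_of_rank {x : P.α} (h : P.rank x = n) : x = ⊤ :=
  eq_of_le_of_rank_le le_top (by rw [h, P.rank_top])

end

variable {P : APolytope.{u} 4}

theorem exists_facet_le {x : P.α} (hx : P.rank x ≤ 3) : ∃ F, P.rank F = 3 ∧ x ≤ F := by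
  obtain ⟨F, hxF, -, hF⟩ := exists_rank_eq (le_top (a := x)) hx (by rw [P.rank_top]; norm_num)
  exact ⟨F, hF, hxF⟩

theorem square_facets {x : P.α} (hx : P.rank x = 2) :
    ∃ F G, F ≠ G ∧ ∀ H, (P.rank H = 3 ∧ x ≤ H) ↔ H = F ∨ H = G := by
  obtain ⟨F, G, hFG, hH⟩ := P.diamond x ⊤ (lt_top_iff_ne_top.2 (by
    rintro rfl
    rw [P.rank_top] at hx
    norm_num at hx)) (by rw [P.rank_top, hx]; norm_num)
  refine ⟨F, G, hFG, fun H => (Iff.trans ?_ (hH H))⟩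
  have ht := P.rank_top
  constructor
  · rintro ⟨hr, hxH⟩
    exact ⟨hxH.lt_of_ne (by rintro rfl; omega), lt_top_iff_ne_top.2 (by rintro rfl; omega)⟩
  · rintro ⟨h1, h2⟩
    have := P.rank_strictMono h1
    have := P.rank_strictMono h2
    exact ⟨by omega, h1.le⟩

/-- The faces below the facet `F` of a rank four polytope are the faces of a cube, with vertices `p`.
-/
structure FacetCoords (P : APolytope.{u} 4) (F : P.α) (p : Fin 8 → P.α) : Prop where
  rank_vertex : ∀ k, P.rank (p k) = 0
  injective : p.Injective
  exists_eq : ∀ v, P.rank v = 0 → ∃ k, p k = v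
  exists_edge : ∀ k i, ∃ e, P.rank e = 1 ∧ ∀ m, p m ≤ e ↔ m = k ∨ m = cubeFlip k i
  edge : ∀ e, P.rank e = 1 → ∃ k i, ∀ m, p m ≤ e ↔ m = k ∨ m = cubeFlip k i
  exists_square : ∀ i a, ∃ x, (P.rank x = 2 ∧ x ≤ F) ∧ ∀ m, p m ≤ x ↔ cubeCoord m i = a
  square : ∀ x, P.rank x = 2 → x ≤ F → ∃ i a, ∀ m, p m ≤ x ↔ cubeCoord m i = a
  le_of_vertices : ∀ x y, x ≤ F → y ≤ F → (∀ m, p m ≤ x → p m ≤ y) → x ≤ y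

theorem FacetCoords.exists_map_cubeFlip {F G : P.α} {p q : Fin 8 → P.α} (hp : FacetCoords P F p)
    (hq : FacetCoords P G q) {σ : Fin 8 → Fin 8} (hσ : ∀ k, p (σ k) = q k) (k : Fin 8)
    (i : Fin 3) : ∃ j, σ (cubeFlip k i) = cubeFlip (σ k) j := by
  obtain ⟨e, he, hm⟩ := hq.exists_edge k i
  obtain ⟨l, j, hl⟩ := hp.edge e he
  have h1 := (hl (σ k)).1 (by rw [hσ, hm]; simp)
  have h2 := (hl (σ (cubeFlip k i))).1 (by rw [hσ, hm]; simp)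
  have h3 : σ (cubeFlip k i) ≠ σ k := fun e =>
    cubeFlip_ne k i (hq.injective (by rw [← hσ, e, hσ]))
  refine ⟨j, ?_⟩
  rcases h1 with h1 | h1 <;> rcases h2 with h2 | h2
  · exact absurd (h2.trans h1.symm) h3
  · rw [h1, h2]
  · rw [h1, h2, cubeFlip_cubeFlip]
  · exact absurd (h2.trans h1.symm) h3

/-- All facets can be coordinatized by the same vertices. -/
theorem FacetCoords.transfer {F G : P.α} {p q : Fin 8 → P.α} (hp : FacetCoords P F p)
    (hq : FacetCoords P G q) : FacetCoords P G p := by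
  choose σ hσ using fun k => hp.exists_eq (q k) (hq.rank_vertex k)
  choose τ hτ using fun k => hq.exists_eq (p k) (hp.rank_vertex k)
  have hσi : σ.Injective := fun k l e => hq.injective (by rw [← hσ, e, hσ])
  have hτi : τ.Injective := fun k l e => hp.injective (by rw [← hτ, e, hτ])
  refine { hp with exists_square := fun i a => ?_, square := fun x hx hxG => ?_,
                   le_of_vertices := fun x y hx hy hxy => ?_ }
  · obtain ⟨i', a', h⟩ := exists_square_image τ hτi (hq.exists_map_cubeFlip hp hτ) i a
    obtain ⟨x, hx, hm⟩ := hq.exists_square i' a'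
    exact ⟨x, hx, fun m => by rw [← hτ, hm, h]⟩
  · obtain ⟨i, a, hm⟩ := hq.square x hx hxG
    obtain ⟨i', a', h⟩ := exists_square_image σ hσi (hp.exists_map_cubeFlip hq hσ) i a
    refine ⟨i', a', fun m => ?_⟩
    have : σ (τ m) = m := hp.injective (by rw [hσ, hτ])
    rw [← hτ, hm, h, this]
  · exact hq.le_of_vertices x y hx hy fun m hm => hσ m ▸ hxy (σ m) (by rwa [hσ])

/-- The polytope has cubical facets and hemioctahedral vertex figures. -/
structure IsCubeHemiocta (P : APolytope.{u} 4) : Prop where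
  facetsAre : P.FacetsAre CubePoset
  vertexFiguresAre : P.VertexFiguresAre HemiOctaPoset

namespace IsCubeHemiocta

theorem exists_facet_faces (h : P.IsCubeHemiocta) {F : P.α} (hF : P.rank F = 3) :
    ∃ f : Fin 28 → P.α, (∀ i j, f i ≤ f j ↔ cubeLE i j) ∧ (∀ x, x ≤ F ↔ ∃ i, f i = x) ∧
      ∀ i, P.rank (f i) = cubeHeight i - 1 := by
  obtain ⟨f, hf, hs⟩ := nonempty_orderIso_cubePoset_iff.1 (h.facetsAre F hF)
  refine ⟨f, hf, hs, fun i => le_antisymm ?_ ?_⟩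
  · have := add_height_le (r := fun i => - P.rank (f i)) (h := fun i => 4 - cubeHeight i) (m := -3)
      (fun i j hij => neg_lt_neg (P.rank_strictMono (lt_iff_le_not_ge.2
        ⟨(hf j i).2 hij.1, fun h => hij.2 ((hf i j).1 h)⟩))) exists_cubeHeight_succ (fun i _ => ?_) i
    · omega
    · have := P.rank_strictMono.monotone ((hs (f i)).2 ⟨i, rfl⟩)
      omega
  · have := add_height_le (r := fun i => P.rank (f i)) (h := fun i => cubeHeight i) (m := -1)
      (fun i j hij => P.rank_strictMono (lt_iff_le_not_ge.2
        ⟨(hf i j).2 hij.1, fun h => hij.2 ((hf j i).1 h)⟩)) exists_cubeHeight_pred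
      (fun i _ => (P.rank_mem _).1) i
    omega

theorem exists_vertexFigure_faces (h : P.IsCubeHemiocta) {v : P.α} (hv : P.rank v = 0) :
    ∃ f : Fin 15 → P.α, (∀ i j, f i ≤ f j ↔ hemicubeLE j i) ∧ (∀ x, v ≤ x ↔ ∃ i, f i = x) ∧
      ∀ i, P.rank (f i) = 4 - hemicubeHeight i := by
  obtain ⟨f, hf, hs⟩ := nonempty_orderIso_hemiOctaPoset_iff.1 (h.vertexFiguresAre v hv)
  refine ⟨f, hf, hs, fun i => le_antisymm ?_ ?_⟩
  · have := add_height_le (r := fun i => - P.rank (f i)) (h := fun i => hemicubeHeight i) (m := -4)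
      (fun i j hij => neg_lt_neg (P.rank_strictMono (lt_iff_le_not_ge.2
        ⟨(hf j i).2 hij.1, fun h => hij.2 ((hf i j).1 h)⟩))) exists_hemicubeHeight_pred
      (fun i _ => neg_le_neg (P.rank_mem _).2) i
    omega
  · have := add_height_le (r := fun i => P.rank (f i)) (h := fun i => 4 - hemicubeHeight i) (m := 0)
      (fun i j hij => P.rank_strictMono (lt_iff_le_not_ge.2
        ⟨(hf i j).2 hij.1, fun h => hij.2 ((hf j i).1 h)⟩)) exists_hemicubeHeight_succ
      (fun i _ => ?_) i
    · omega
    · have := P.rank_strictMono.monotone ((hs (f i)).2 ⟨i, rfl⟩)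
      omega

theorem edge_le_of_vertex_le (h : P.IsCubeHemiocta) {v e F : P.α} (hv : P.rank v = 0) (he : P.rank e = 1)
    (hF : P.rank F = 3) (hve : v ≤ e) (hvF : v ≤ F) : e ≤ F := by
  obtain ⟨f, hf, hs, hr⟩ := h.exists_vertexFigure_faces hv
  obtain ⟨i, rfl⟩ := (hs e).1 hve
  obtain ⟨j, rfl⟩ := (hs F).1 hvF
  have := hr i
  have := hr j
  exact (hf i j).2 (hemicube_edge_cell j i (by omega) (by omega))

theorem vertex_le (h : P.IsCubeHemiocta) {v F : P.α} (hv : P.rank v = 0) (hF : P.rank F = 3) :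
    v ≤ F := by
  obtain ⟨c, hc, hFc, -⟩ := exists_isMaxChain_mem (le_refl F)
  obtain ⟨d, hd, hvd, -⟩ := exists_isMaxChain_mem (le_refl v)
  suffices ∀ x y : Set P.α, Relation.ReflTransGen
      (fun x y : Set P.α => IsMaxChain (· ≤ ·) y ∧ c ∩ d ⊆ y ∧
        (∃ F G : P.α, x \ y = {F} ∧ y \ x = {G})) x y → IsMaxChain (· ≤ ·) x →
      (∀ v ∈ x, P.rank v = 0 → v ≤ F) → IsMaxChain (· ≤ ·) y ∧ ∀ v ∈ y, P.rank v = 0 → v ≤ F from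
    (this c d (P.connected c d hc hd) hc fun v hvc hv =>
      (hc.1.lt_of_rank_lt P.rank_strictMono hvc hFc (by omega)).le).2 v hvd hv
  intro x y hxy hx hxF
  induction hxy with
  | refl => exact ⟨hx, hxF⟩
  | @tail y z _ hyz ih =>
    obtain ⟨hz, -, A, B, hA, hB⟩ := hyz
    refine ⟨hz, fun w hwz hw => ?_⟩
    obtain ⟨hy, hyF⟩ := ih
    by_cases hwy : w ∈ y
    · exact hyF w hwy hw
    obtain ⟨v, ⟨hvy, hv⟩, -⟩ := P.flag_ranks y hy 0 (by norm_num)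
    obtain ⟨e, ⟨hey, he⟩, -⟩ := P.flag_ranks y hy 1 (by norm_num)
    have hvz : v ∉ z := fun hvz =>
      hwy (hz.1.eq_of_rank_eq P.rank_strictMono hvz hwz (by omega) ▸ hvy)
    have hez : e ∈ z := by
      by_contra hez
      have h1 : v ∈ ({A} : Set P.α) := hA ▸ ⟨hvy, hvz⟩
      have h2 : e ∈ ({A} : Set P.α) := hA ▸ ⟨hey, hez⟩
      rw [Set.mem_singleton_iff.1 h1] at hv
      rw [Set.mem_singleton_iff.1 h2] at he
      omega
    exact (hz.1.lt_of_rank_lt P.rank_strictMono hwz hez (by omega)).le.trans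
      (h.edge_le_of_vertex_le hv he hF
        (hy.1.lt_of_rank_lt P.rank_strictMono hvy hey (by omega)).le (hyF v hvy hv))

theorem edge_le (h : P.IsCubeHemiocta) {e F : P.α} (he : P.rank e = 1) (hF : P.rank F = 3) :
    e ≤ F := by
  obtain ⟨v, -, hve, hv⟩ := exists_rank_eq (bot_le (a := e)) (i := 0) (by rw [P.rank_bot]; omega)
    (by omega)
  exact h.edge_le_of_vertex_le hv he hF hve (h.vertex_le hv hF)

theorem exists_common_square (h : P.IsCubeHemiocta) {v F G : P.α} (hv : P.rank v = 0)
    (hF : P.rank F = 3) (hG : P.rank G = 3) (hFG : F ≠ G) :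
    ∃ x, (P.rank x = 2 ∧ v ≤ x ∧ x ≤ F ∧ x ≤ G) ∧
      ∀ y, P.rank y = 2 → v ≤ y → y ≤ F → y ≤ G → y = x := by
  obtain ⟨f, hf, hs, hr⟩ := h.exists_vertexFigure_faces hv
  obtain ⟨i, rfl⟩ := (hs F).1 (h.vertex_le hv hF)
  obtain ⟨j, rfl⟩ := (hs G).1 (h.vertex_le hv hG)
  have := hr i
  have := hr j
  obtain ⟨z, ⟨hz, hzi, hzj⟩, hu⟩ := hemicube_common i j (by omega) (by omega)
    fun e => hFG (congrArg f e)
  refine ⟨f z, ⟨by rw [hr, hz]; rfl, (hs _).2 ⟨z, rfl⟩, (hf _ _).2 hzi, (hf _ _).2 hzj⟩,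
    fun y hy hvy hyi hyj => ?_⟩
  obtain ⟨w, rfl⟩ := (hs y).1 hvy
  have := hr w
  rw [hu w (by omega) ((hf _ _).1 hyi) ((hf _ _).1 hyj)]

theorem exists_facetCoords (h : P.IsCubeHemiocta) {F : P.α} (hF : P.rank F = 3) :
    ∃ p, FacetCoords P F p := by
  obtain ⟨f, hf, hs, hr⟩ := h.exists_facet_faces hF
  refine ⟨fun k => f (vertexIdx k), ⟨fun k => ?_, fun k l hkl => ?_, fun v hv => ?_, fun k i => ?_,
    fun e he => ?_, fun i a => ?_, fun x hx hxF => ?_, fun x y hx hy hxy => ?_⟩⟩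
  · rw [hr, cubeHeight_vertexIdx]
    rfl
  · have h1 := (hf _ _).1 hkl.le
    have h2 := (hf _ _).1 hkl.ge
    exact cubeLE_vertexIdx _ _ h1
  · obtain ⟨j, rfl⟩ := (hs v).1 (h.vertex_le hv hF)
    have := hr j
    obtain ⟨k, rfl⟩ := exists_vertexIdx_eq j (by omega)
    exact ⟨k, rfl⟩
  · obtain ⟨j, hj, hm⟩ := exists_cube_edge k i
    exact ⟨f j, by rw [hr, hj]; rfl, fun m => (hf _ _).trans (hm m)⟩
  · obtain ⟨j, rfl⟩ := (hs e).1 (h.edge_le he hF)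
    have := hr j
    obtain ⟨k, i, hm⟩ := cube_edge j (by omega)
    exact ⟨k, i, fun m => (hf _ _).trans (hm m)⟩
  · obtain ⟨j, hj, hm⟩ := exists_cube_square i a
    exact ⟨f j, ⟨by rw [hr, hj]; rfl, (hs _).2 ⟨j, rfl⟩⟩, fun m => (hf _ _).trans (hm m)⟩
  · obtain ⟨j, rfl⟩ := (hs x).1 hxF
    have := hr j
    obtain ⟨i, a, hm⟩ := cube_square j (by omega)
    exact ⟨i, a, fun m => (hf _ _).trans (hm m)⟩
  · obtain ⟨i, rfl⟩ := (hs x).1 hx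
    obtain ⟨j, rfl⟩ := (hs y).1 hy
    exact (hf _ _).2 (cubeLE_of_vertexIdx _ _ fun m hm => (hf _ _).1 (hxy m ((hf _ _).2 hm)))

theorem exists_coords (h : P.IsCubeHemiocta) :
    ∃ p, ∀ F, P.rank F = 3 → FacetCoords P F p := by
  obtain ⟨F, hF, -⟩ := exists_facet_le (P := P) (x := ⊥) (by rw [P.rank_bot]; norm_num)
  obtain ⟨p, hp⟩ := h.exists_facetCoords hF
  refine ⟨p, fun G hG => ?_⟩
  obtain ⟨q, hq⟩ := h.exists_facetCoords hG
  exact hp.transfer hq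

end IsCubeHemiocta

end APolytope

namespace APolytope

variable {P : APolytope.{u} 4}

/-- The facets `F` and `G` share the square spanned by the vertices with `j`-th coordinate `a`. -/
def CommonSquare (P : APolytope.{u} 4) (p : Fin 8 → P.α) (F G : P.α) (a : Bool) (j : Fin 3) :
    Prop :=
  ∃ x, P.rank x = 2 ∧ x ≤ F ∧ x ≤ G ∧ ∀ m, p m ≤ x ↔ cubeCoord m j = a

theorem CommonSquare.symm {p : Fin 8 → P.α} {F G : P.α} {a : Bool} {j : Fin 3}
    (h : CommonSquare P p F G a j) : CommonSquare P p G F a j := by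
  obtain ⟨x, hx, hF, hG, hm⟩ := h
  exact ⟨x, hx, hG, hF, hm⟩

theorem eq_or_eq_of_square_le {x F G H : P.α} (hx : P.rank x = 2) (hF : P.rank F = 3)
    (hG : P.rank G = 3) (hH : P.rank H = 3) (hxF : x ≤ F) (hxG : x ≤ G) (hxH : x ≤ H)
    (hFG : F ≠ G) : H = F ∨ H = G := by
  obtain ⟨A, B, -, hAB⟩ := square_facets hx
  have := (hAB F).1 ⟨hF, hxF⟩
  have := (hAB G).1 ⟨hG, hxG⟩
  have := (hAB H).1 ⟨hH, hxH⟩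
  grind

theorem FacetCoords.eq_of_vertices {F : P.α} {p : Fin 8 → P.α} (hp : FacetCoords P F p) {x y : P.α}
    {a : Bool} {j : Fin 3} (hx : x ≤ F) (hy : y ≤ F) (hxm : ∀ m, p m ≤ x ↔ cubeCoord m j = a)
    (hym : ∀ m, p m ≤ y ↔ cubeCoord m j = a) : x = y :=
  le_antisymm (hp.le_of_vertices x y hx hy fun m h => (hym m).2 ((hxm m).1 h))
    (hp.le_of_vertices y x hy hx fun m h => (hxm m).2 ((hym m).1 h))

theorem FacetCoords.eq_of_commonSquare {F G H : P.α} {p : Fin 8 → P.α} (hp : FacetCoords P F p)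
    (hF : P.rank F = 3) (hG : P.rank G = 3) (hH : P.rank H = 3) (hFG : F ≠ G) (hFH : F ≠ H)
    {a : Bool} {j : Fin 3} (h₁ : CommonSquare P p F G a j) (h₂ : CommonSquare P p F H a j) :
    G = H := by
  obtain ⟨x, hx, hxF, hxG, hxm⟩ := h₁
  obtain ⟨y, hy, hyF, hyH, hym⟩ := h₂
  obtain rfl := hp.eq_of_vertices hxF hyF hxm hym
  exact ((eq_or_eq_of_square_le hx hF hG hH hxF hxG hyH hFG).resolve_left hFH.symm).symm

namespace IsCubeHemiocta

theorem exists_commonSquare_iff (h : P.IsCubeHemiocta) {p : Fin 8 → P.α} {F G : P.α}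
    (hp : FacetCoords P F p) (hF : P.rank F = 3) (hG : P.rank G = 3) (hFG : F ≠ G) :
    ∃ i, ∀ a j, CommonSquare P p F G a j ↔ j = i := by
  classical
  obtain ⟨i, hi⟩ := exists_axis (fun a j => decide (CommonSquare P p F G a j)) fun k => by
    obtain ⟨x, ⟨hx, hkx, hxF, hxG⟩, hu⟩ := h.exists_common_square (hp.rank_vertex k) hF hG hFG
    obtain ⟨j, a, hm⟩ := hp.square x hx hxF
    obtain rfl := (hm k).1 hkx
    refine ⟨j, decide_eq_true ⟨x, hx, hxF, hxG, hm⟩, fun l hl => ?_⟩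
    obtain ⟨y, hy, hyF, hyG, hym⟩ := of_decide_eq_true hl
    obtain rfl := hu y hy ((hym k).2 rfl) hyF hyG
    exact cubeCoord_eq_iff_injective _ _ _ _ fun m => (hym m).symm.trans (hm m)
  exact ⟨i, fun a j => by simpa using hi a j⟩

/-- The facets can be labelled such that the common squares of two facets are orthogonal to the
direction determined by their labels. -/
theorem exists_facet_labels (h : P.IsCubeHemiocta) {p : Fin 8 → P.α}
    (hp : ∀ F, P.rank F = 3 → FacetCoords P F p) :
    ∃ q : Fin 4 → P.α, (∀ c, P.rank (q c) = 3) ∧ q.Injective ∧ (∀ F, P.rank F = 3 → ∃ c, q c = F) ∧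
      ∀ c d, c ≠ d → ∀ a j, CommonSquare P p (q c) (q d) a j ↔ j.succ = c ^^^ d := by
  obtain ⟨F, hF, -⟩ := exists_facet_le (P := P) (x := ⊥) (by rw [P.rank_bot]; norm_num)
  have key : ∀ i, ∃ G, (P.rank G = 3 ∧ F ≠ G) ∧ ∀ a j, CommonSquare P p F G a j ↔ j = i := by
    intro i
    obtain ⟨x, ⟨hx, hxF⟩, hm⟩ := (hp F hF).exists_square i false
    obtain ⟨A, B, hAB, hH⟩ := square_facets hx
    obtain ⟨G, hG, hxG, hFG⟩ : ∃ G, P.rank G = 3 ∧ x ≤ G ∧ F ≠ G := by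
      rcases (hH F).1 ⟨hF, hxF⟩ with rfl | rfl
      · exact ⟨B, ((hH B).2 (.inr rfl)).1, ((hH B).2 (.inr rfl)).2, hAB⟩
      · exact ⟨A, ((hH A).2 (.inl rfl)).1, ((hH A).2 (.inl rfl)).2, hAB.symm⟩
    obtain ⟨i', hi'⟩ := h.exists_commonSquare_iff (hp F hF) hF hG hFG
    obtain rfl := (hi' false i).1 ⟨x, hx, hxF, hxG, hm⟩
    exact ⟨G, ⟨hG, hFG⟩, hi'⟩
  choose G hG hFG using key
  have hGi : G.Injective := fun i j hij => (hFG j false i).1 (hij ▸ (hFG i false i).2 rfl)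
  have hGG : ∀ i j, i ≠ j → ∀ a l, CommonSquare P p (G i) (G j) a l ↔ l.succ = i.succ ^^^ j.succ := by
    intro i j hij a l
    obtain ⟨k, hk⟩ := h.exists_commonSquare_iff (hp _ (hG i).1) (hG i).1 (hG j).1 (hGi.ne hij)
    have hne : ∀ i j, i ≠ j → (∀ a l, CommonSquare P p (G i) (G j) a l ↔ l = k) → k ≠ i := by
      rintro i j hij hk rfl
      exact (hG j).2 ((hp _ (hG k).1).eq_of_commonSquare (hG k).1 hF (hG j).1 (hG k).2.symm
        (hGi.ne hij) ((hFG k false k).2 rfl).symm ((hk false k).2 rfl))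
    rw [hk, ← succ_xor_succ k i j (hne i j hij hk)
      (hne j i hij.symm fun a l => ⟨fun h => (hk a l).1 h.symm, fun h => ((hk a l).2 h).symm⟩) hij,
      Fin.succ_inj]
  refine ⟨Fin.cons F G, fun c => ?_, ?_, fun H hH => ?_, fun c d hcd a j => ?_⟩
  · cases c using Fin.cases with
    | zero => exact hF
    | succ i => exact (hG i).1
  · rw [Fin.cons_injective_iff]
    exact ⟨fun ⟨i, hi⟩ => (hG i).2 hi.symm, hGi⟩
  · by_cases hFH : F = H
    · exact ⟨0, hFH⟩
    obtain ⟨i, hi⟩ := h.exists_commonSquare_iff (hp F hF) hF hH hFH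
    exact ⟨i.succ, (hp F hF).eq_of_commonSquare hF (hG i).1 hH (hG i).2 hFH
      ((hFG i false i).2 rfl) ((hi false i).2 rfl)⟩
  · cases c using Fin.cases with
    | zero =>
      cases d using Fin.cases with
      | zero => exact absurd rfl hcd
      | succ i =>
        rw [show 0 ^^^ i.succ = i.succ by decide +revert, Fin.succ_inj]
        exact hFG i a j
    | succ i =>
      cases d using Fin.cases with
      | zero =>
        rw [Fin.xor_zero, Fin.succ_inj]
        exact ⟨fun h => (hFG i a j).1 h.symm, fun h => ((hFG i a j).2 h).symm⟩
      | succ k => exact hGG i k (fun e => hcd (congrArg _ e)) a j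

end IsCubeHemiocta

end APolytope

/-- The pairs consisting of the vertices and of the facets incident with a face of the polytope. -/
inductive IsFaceType : Set (Fin 8) × (Set (Fin 4))ᵒᵈ → Prop
  | bot : IsFaceType (∅, OrderDual.toDual Set.univ)
  | vertex (k : Fin 8) : IsFaceType ({k}, OrderDual.toDual Set.univ)
  | edge (k : Fin 8) (i : Fin 3) : IsFaceType ({k, cubeFlip k i}, OrderDual.toDual Set.univ)
  | square (i : Fin 3) (a : Bool) (c : Fin 4) :
    IsFaceType ({m | cubeCoord m i = a}, OrderDual.toDual {c, c ^^^ i.succ})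
  | facet (c : Fin 4) : IsFaceType (Set.univ, OrderDual.toDual {c})
  | top : IsFaceType (Set.univ, OrderDual.toDual ∅)

namespace APolytope

/-- The pair consisting of the vertices and of the facets incident with a face. -/
def faceType (P : APolytope.{u} 4) (p : Fin 8 → P.α) (q : Fin 4 → P.α) (x : P.α) :
    Set (Fin 8) × (Set (Fin 4))ᵒᵈ :=
  ({k | p k ≤ x}, OrderDual.toDual {c | x ≤ q c})

theorem faceType_eq {P : APolytope.{u} 4} {p : Fin 8 → P.α} {q : Fin 4 → P.α} {x : P.α}
    {s : Set (Fin 8)} {t : Set (Fin 4)} (hs : ∀ k, p k ≤ x ↔ k ∈ s) (ht : ∀ c, x ≤ q c ↔ c ∈ t) :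
    P.faceType p q x = (s, OrderDual.toDual t) :=
  Prod.ext (Set.ext hs) (congrArg OrderDual.toDual (Set.ext ht))

theorem IsCubeHemiocta.exists_orderEmbedding {P : APolytope.{u} 4} (h : P.IsCubeHemiocta) :
    ∃ e : P.α ↪o Set (Fin 8) × (Set (Fin 4))ᵒᵈ, Set.range e = {r | IsFaceType r} := by
  obtain ⟨p, hp⟩ := h.exists_coords
  obtain ⟨q, hq, hqi, hqs, hc⟩ := h.exists_facet_labels hp
  have hp0 := hp _ (hq 0)
  have hpr := hp0.rank_vertex
  have hbot := P.rank_bot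
  have htop := P.rank_top
  push_cast at htop
  have hmono := P.rank_strictMono.monotone
  have hle : ∀ x y, P.faceType p q x ≤ P.faceType p q y ↔ x ≤ y := by
    intro x y
    refine ⟨fun ⟨hv, hf⟩ => ?_, fun hxy => ⟨fun k hk => le_trans hk hxy, fun c hc => hxy.trans hc⟩⟩
    by_cases hy : P.rank y ≤ 3
    · obtain ⟨F, hF, hyF⟩ := exists_facet_le hy
      obtain ⟨c, rfl⟩ := hqs F hF
      exact (hp _ hF).le_of_vertices x y (hf hyF) hyF fun m hm => hv hm
    · have := (P.rank_mem y).2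
      push_cast at this
      rw [eq_top_of_rank (x := y) (by push_cast; omega)]
      exact le_top
  have h_bot : P.faceType p q ⊥ = (∅, OrderDual.toDual Set.univ) :=
    faceType_eq (fun k => iff_of_false (fun hk => by have := hmono hk; have := hpr k; omega) id)
      fun c => iff_of_true bot_le trivial
  have h_top : P.faceType p q ⊤ = (Set.univ, OrderDual.toDual ∅) :=
    faceType_eq (fun k => iff_of_true le_top trivial) fun c =>
      iff_of_false (fun hk => by have := hmono hk; have := hq c; omega) id
  have h_vertex : ∀ k, P.faceType p q (p k) = ({k}, OrderDual.toDual Set.univ) := fun k =>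
    faceType_eq (fun l => ⟨fun hl => hp0.injective
      (eq_of_le_of_rank_le hl (by rw [hpr, hpr])), fun hl => hl ▸ le_rfl⟩)
      fun c => iff_of_true (h.vertex_le (hpr k) (hq c)) trivial
  have h_edge : ∀ e k i, P.rank e = 1 → (∀ m, p m ≤ e ↔ m = k ∨ m = cubeFlip k i) →
      P.faceType p q e = ({k, cubeFlip k i}, OrderDual.toDual Set.univ) := fun e k i he hm =>
    faceType_eq hm fun c => iff_of_true (h.edge_le he (hq c)) trivial
  have h_facet : ∀ c, P.faceType p q (q c) = (Set.univ, OrderDual.toDual {c}) := fun c =>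
    faceType_eq (fun k => iff_of_true (h.vertex_le (hpr k) (hq c)) trivial)
      fun d => ⟨fun hd => (hqi (eq_of_le_of_rank_le hd (by rw [hq, hq]))).symm,
        fun hd => hd ▸ le_rfl⟩
  have h_square : ∀ i a c, ∃ x, P.rank x = 2 ∧ x ≤ q c ∧ (∀ m, p m ≤ x ↔ cubeCoord m i = a) ∧
      P.faceType p q x = ({m | cubeCoord m i = a}, OrderDual.toDual {c, c ^^^ i.succ}) := by
    intro i a c
    obtain ⟨x, hx, hxc, hxd, hm⟩ :=
      (hc c (c ^^^ i.succ) (xor_succ_ne i c) a i).2 ((succ_eq_xor_iff _ _ _).2 rfl)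
    refine ⟨x, hx, hxc, hm, faceType_eq hm fun d => ⟨fun hd => ?_, ?_⟩⟩
    · exact (eq_or_eq_of_square_le hx (hq _) (hq _) (hq d) hxc hxd hd
        (hqi.ne (xor_succ_ne i c))).imp (fun e => hqi e) fun e => hqi e
    · rintro (rfl | rfl)
      · exact hxc
      · exact hxd
  refine ⟨OrderEmbedding.ofMapLEIff (P.faceType p q) hle, Set.Subset.antisymm ?_ fun r hr => ?_⟩
  · rintro _ ⟨x, rfl⟩
    change IsFaceType (P.faceType p q x)
    obtain ⟨h1, h2⟩ := P.rank_mem x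
    push_cast at h2
    obtain hx | hx | hx | hx | hx | hx : P.rank x = -1 ∨ P.rank x = 0 ∨ P.rank x = 1 ∨
      P.rank x = 2 ∨ P.rank x = 3 ∨ P.rank x = 4 := by omega
    · rw [eq_bot_of_rank hx, h_bot]
      exact .bot
    · obtain ⟨k, rfl⟩ := hp0.exists_eq x hx
      rw [h_vertex]
      exact .vertex k
    · obtain ⟨k, i, hm⟩ := hp0.edge x hx
      rw [h_edge x k i hx hm]
      exact .edge k i
    · obtain ⟨F, hF, hxF⟩ := exists_facet_le (hx.trans_le (by norm_num))
      obtain ⟨c, rfl⟩ := hqs F hF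
      obtain ⟨i, a, hm⟩ := (hp _ hF).square x hx hxF
      obtain ⟨y, -, hyc, hym, hy⟩ := h_square i a c
      rw [(hp _ hF).eq_of_vertices hxF hyc hm hym, hy]
      exact .square i a c
    · obtain ⟨c, rfl⟩ := hqs x hx
      rw [h_facet]
      exact .facet c
    · rw [eq_top_of_rank hx, h_top]
      exact .top
  · cases hr with
    | bot => exact ⟨⊥, h_bot⟩
    | vertex k => exact ⟨p k, h_vertex k⟩
    | edge k i =>
      obtain ⟨e, he, hm⟩ := hp0.exists_edge k i
      exact ⟨e, h_edge e k i he hm⟩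
    | square i a c =>
      obtain ⟨x, -, -, -, hx⟩ := h_square i a c
      exact ⟨x, hx⟩
    | facet c => exact ⟨q c, h_facet c⟩
    | top => exact ⟨⊤, h_top⟩

theorem IsCubeHemiocta.iso {P : APolytope.{u} 4} {Q : APolytope.{v} 4} (hP : P.IsCubeHemiocta)
    (hQ : Q.IsCubeHemiocta) : P.Iso Q := by
  obtain ⟨e, he⟩ := hP.exists_orderEmbedding
  obtain ⟨f, hf⟩ := hQ.exists_orderEmbedding
  exact ⟨e.orderIso.trans ((OrderIso.setCongr _ _ (he.trans hf.symm)).trans f.orderIso.symm)⟩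

end APolytope

/-- There exists a rank-4 abstract polytope all of whose facets are isomorphic to the
cube `{4,3}` and all of whose vertex figures are isomorphic to the hemioctahedron
`{3,4}₃`, and any two such polytopes are isomorphic. -/
theorem statement_3 :
    (∃ P : APolytope.{u} 4, P.FacetsAre CubePoset ∧ P.VertexFiguresAre HemiOctaPoset) ∧
    (∀ (P : APolytope.{u} 4) (Q : APolytope.{v} 4),
      P.FacetsAre CubePoset → P.VertexFiguresAre HemiOctaPoset →
      Q.FacetsAre CubePoset → Q.VertexFiguresAre HemiOctaPoset → P.Iso Q) := by
  exact ⟨⟨cellPolytope, cellPolytope_facetsAre, cellPolytope_vertexFiguresAre⟩,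
    fun _ _ hP hP' hQ hQ' => APolytope.IsCubeHemiocta.iso ⟨hP, hP'⟩ ⟨hQ, hQ'⟩⟩
end

section
/- There exists a rank-4 abstract polytope all of whose facets are isomorphic to the hemi-icosahedron {3,5}₅ and all of whose vertex figures are isomorphic to the hemidodecahedron {5,3}₅ (the 11-cell); any two such polytopes are isomorphic; and any such polytope has exactly 11 faces of rank 3 and its automorphism group has order 660. -/
universe u v

def HemiIcosaPosetData : Finset (Finset (Fin 33)) :=
  {{0},
   {0, 1},
   {0, 2},
   {0, 3},
   {0, 4},
   {0, 5},
   {0, 6},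
   {0, 1, 2, 7},
   {0, 1, 3, 8},
   {0, 1, 5, 9},
   {0, 1, 4, 10},
   {0, 1, 6, 11},
   {0, 2, 3, 12},
   {0, 2, 6, 13},
   {0, 2, 4, 14},
   {0, 2, 5, 15},
   {0, 3, 4, 16},
   {0, 3, 5, 17},
   {0, 3, 6, 18},
   {0, 4, 5, 19},
   {0, 4, 6, 20},
   {0, 5, 6, 21},
   {0, 1, 2, 3, 7, 8, 12, 22},
   {0, 1, 2, 4, 7, 10, 14, 23},
   {0, 1, 3, 6, 8, 11, 18, 24},
   {0, 1, 4, 5, 9, 10, 19, 25},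
   {0, 1, 5, 6, 9, 11, 21, 26},
   {0, 2, 3, 5, 12, 15, 17, 27},
   {0, 2, 4, 6, 13, 14, 20, 28},
   {0, 2, 5, 6, 13, 15, 21, 29},
   {0, 3, 4, 5, 16, 17, 19, 30},
   {0, 3, 4, 6, 16, 18, 20, 31},
   {0, 1, 2, 3, 4, 5, 6, 7, 8, 9, 10, 11, 12, 13, 14, 15, 16, 17, 18, 19, 20, 21, 22, 23, 24, 25, 26, 27, 28, 29, 30, 31, 32}}

abbrev HemiIcosaPoset := {S : Finset (Fin 33) // S ∈ HemiIcosaPosetData}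

/-- The hemidodecahedron is the order dual of the hemi-icosahedron. -/
abbrev HemiDodecaPoset := HemiIcosaPosetᵒᵈ

/-! ### The flags of the hemi-icosahedron -/

namespace HemiIcosa

/-- The vertex sets of the 33 faces of the hemi-icosahedron, as bit masks. -/
def masks : List ℕ :=
  [0, 1, 2, 4, 8, 16, 32, 3, 5, 17, 9, 33, 6, 34, 10, 18, 12, 20, 36, 24, 40, 48, 7, 11, 37,
   25, 49, 22, 42, 50, 28, 44, 63]

/-- The vertex set of the face with label `k`. -/
def mask (k : Fin 33) : ℕ := masks.getD k 0

/-- Incidence of faces, in terms of their labels. -/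
def Sub (k l : Fin 33) : Prop := mask k &&& mask l = mask k

instance (k l : Fin 33) : Decidable (Sub k l) := inferInstanceAs (Decidable (_ = _))

/-- The labels of the vertex, the edge and the triangle of each of the 60 flags. -/
def flagTable : List (List (Fin 33)) :=
  [[1,7,22], [2,7,22], [1,8,22], [1,7,23], [2,12,22], [2,7,23], [3,8,22], [1,8,24], [1,10,23],
   [3,12,22], [2,12,27], [2,14,23], [3,8,24], [1,11,24], [4,10,23], [1,10,25], [3,12,27],
   [2,15,27], [4,14,23], [2,14,28], [3,18,24], [6,11,24], [1,11,26], [4,10,25], [1,9,25],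
   [3,17,27], [5,15,27], [2,15,29], [4,14,28], [2,13,28], [6,18,24], [3,18,31], [6,11,26],
   [1,9,26], [4,19,25], [5,9,25], [5,17,27], [3,17,30], [5,15,29], [2,13,29], [4,20,28],
   [6,13,28], [6,18,31], [3,16,31], [6,21,26], [5,9,26], [5,19,25], [4,19,30], [5,17,30],
   [3,16,30], [5,21,29], [6,13,29], [6,20,28], [4,20,31], [6,20,31], [4,16,31], [5,21,26],
   [6,21,29], [5,19,30], [4,16,30]]

/-- The label of the face of rank `j` of the flag `h`. -/
def face (h : Fin 60) (j : Fin 3) : Fin 33 := (flagTable.getD h []).getD j 0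

/-- For each rank, the flags adjacent to the 60 flags. -/
def reflTable : List (List (Fin 60)) :=
  [[1, 0, 6, 5, 9, 3, 2, 12, 14, 4, 16, 18, 7, 21, 8, 23, 10, 26, 11, 28, 30, 13, 32, 15, 35,
    36, 17, 38, 19, 41, 20, 42, 22, 45, 46, 24, 25, 48, 27, 51, 52, 29, 31, 55, 56, 33, 34,
    58, 37, 59, 57, 39, 40, 54, 53, 43, 44, 50, 47, 49],
   [2, 4, 0, 8, 1, 11, 9, 13, 3, 6, 17, 5, 20, 7, 18, 24, 25, 10, 14, 29, 12, 30, 33, 34, 15,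
    16, 36, 39, 40, 19, 21, 43, 44, 22, 23, 46, 26, 49, 50, 27, 28, 52, 54, 31, 32, 56, 35,
    59, 58, 37, 38, 57, 41, 55, 42, 53, 45, 51, 48, 47],
   [3, 5, 7, 0, 10, 1, 12, 2, 15, 16, 4, 19, 6, 22, 23, 8, 9, 27, 28, 11, 31, 32, 13, 14, 33,
    37, 38, 17, 18, 39, 42, 20, 21, 24, 47, 45, 48, 25, 26, 29, 53, 51, 30, 49, 57, 35, 58,
    34, 36, 43, 56, 41, 54, 40, 52, 59, 50, 44, 46, 55]]

/-- The flag differing from `h` exactly in its face of rank `j`. -/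
def refl (j : Fin 3) (h : Fin 60) : Fin 60 := (reflTable.getD j []).getD h 0

/-- The action on flags of the automorphisms sending flag `0` to its adjacent flags. -/
def autTable : List (List (Fin 60)) :=
  [[1, 0, 4, 5, 2, 3, 9, 10, 11, 6, 7, 8, 16, 17, 18, 19, 12, 13, 14, 15, 25, 26, 27, 28, 29,
    20, 21, 22, 23, 24, 36, 37, 38, 39, 40, 41, 30, 31, 32, 33, 34, 35, 48, 49, 50, 51, 52,
    53, 42, 43, 44, 45, 46, 47, 58, 59, 57, 56, 54, 55],
   [2, 6, 0, 7, 9, 12, 1, 3, 13, 4, 16, 20, 5, 8, 21, 22, 10, 25, 30, 31, 11, 14, 15, 32, 33,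
    17, 36, 37, 42, 43, 18, 19, 23, 24, 44, 45, 26, 27, 48, 49, 54, 55, 28, 29, 34, 35, 56,
    57, 38, 39, 58, 59, 53, 52, 40, 41, 46, 47, 50, 51],
   [3, 5, 8, 0, 11, 1, 14, 15, 2, 18, 19, 4, 23, 24, 6, 7, 28, 29, 9, 10, 34, 35, 33, 12, 13,
    40, 41, 39, 16, 17, 46, 47, 45, 22, 20, 21, 52, 53, 51, 27, 25, 26, 58, 59, 56, 32, 30,
    31, 54, 55, 57, 38, 36, 37, 48, 49, 44, 50, 42, 43]]

/-- The action on flags of the automorphism sending flag `0` to `refl j 0`. -/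
def aut (j : Fin 3) (h : Fin 60) : Fin 60 := (autTable.getD j []).getD h 0

/-- The action of a word in the generators. -/
def act {ι X : Type*} (r : ι → X → X) (w : List ι) (x : X) : X := w.foldr r x

theorem act_append {ι X : Type*} (r : ι → X → X) (u v : List ι) (x : X) :
    act r (u ++ v) x = act r u (act r v x) := List.foldr_append

theorem face_eq_of_chain : ∀ a b : Fin 33, Sub a b → a ≠ b → ∀ c, Sub b c → b ≠ c →
    ∀ d, Sub c d → c ≠ d → ∀ e, Sub d e → d ≠ e →
    ∃ h, face h 0 = b ∧ face h 1 = c ∧ face h 2 = d := by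
  decide +kernel

theorem refl_eq : ∀ (j : Fin 3) (h h' : Fin 60), face h j ≠ face h' j →
    (∀ i, i ≠ j → face h i = face h' i) → h' = refl j h := by
  decide +kernel

theorem refl_aut : ∀ (i j : Fin 3) (h : Fin 60), refl j (aut i h) = aut i (refl j h) := by
  decide +kernel

theorem aut_zero : ∀ j : Fin 3, aut j 0 = refl j 0 := by
  decide +kernel

/-- The words in the first two generators. -/
def shortWords : List (List (Fin 3)) := [[], [0], [1], [0, 1], [1, 0], [0, 1, 0]]

/-- Representatives of the double cosets of the triangle group. -/
def middleWords : List (List (Fin 3)) := [[], [2], [2, 1, 2]]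

theorem exists_word : ∀ h : Fin 60, ∃ d ∈ shortWords, ∃ x ∈ middleWords, ∃ d' ∈ shortWords,
    act refl (d ++ x ++ d') 0 = h := by
  decide +kernel

theorem exists_word_zero (h : Fin 60) : ∃ w, act refl w 0 = h := by
  obtain ⟨d, -, x, -, d', -, h⟩ := exists_word h
  exact ⟨_, h⟩

theorem exists_aut (w : List (Fin 3)) : ∃ σ : Fin 60 → Fin 60,
    (∀ j h, refl j (σ h) = σ (refl j h)) ∧ σ 0 = act refl w 0 := by
  induction w with
  | nil => exact ⟨id, fun _ _ => rfl, rfl⟩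
  | cons j w ih =>
    obtain ⟨σ, hσ, h0⟩ := ih
    refine ⟨σ ∘ aut j, fun i h => ?_, ?_⟩
    · simp [hσ, refl_aut]
    · simp only [Function.comp, aut_zero, ← hσ, h0]
      rfl

theorem act_comm {σ : Fin 60 → Fin 60} (hσ : ∀ j h, refl j (σ h) = σ (refl j h))
    (w : List (Fin 3)) (h : Fin 60) : act refl w (σ h) = σ (act refl w h) := by
  induction w with
  | nil => rfl
  | cons j w ih => exact (congrArg (refl j) ih).trans (hσ _ _)

theorem act_congr {u v : List (Fin 3)} (huv : act refl u 0 = act refl v 0) (h : Fin 60) :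
    act refl u h = act refl v h := by
  obtain ⟨w, rfl⟩ := exists_word_zero h
  obtain ⟨σ, hσ, h0⟩ := exists_aut w
  rw [← h0, act_comm hσ, act_comm hσ, huv]

theorem act_act_reverse (w : List (Fin 3)) (h : Fin 60) :
    act refl w (act refl w.reverse h) = h := by
  have inv : ∀ j h, refl j (refl j h) = h := by decide +kernel
  induction w generalizing h with
  | nil => rfl
  | cons j w ih =>
    rw [List.reverse_cons, act_append]
    exact (congrArg (refl j) (ih _)).trans (inv j h)

theorem act_zero_of_act_eq {w : List (Fin 3)} {h : Fin 60} (hw : act refl w h = h) :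
    act refl w 0 = 0 := by
  obtain ⟨u, rfl⟩ := exists_word_zero h
  obtain ⟨σ, hσ, h0⟩ := exists_aut u.reverse
  have := congrArg σ hw
  rwa [← act_comm hσ, ← act_comm hσ, h0, act_act_reverse] at this

end HemiIcosa

/-! ### The 11-cell -/

namespace ElevenCell

/-- The translate by `i` of a set of integers mod 11 given as a bit mask. -/
def translate (i m : ℕ) : ℕ := (m <<< i ||| m >>> (11 - i)) &&& 2047

/-- The vertex sets of the faces of rank `r - 1`, as bit masks. -/
def cells : Fin 6 → List ℕ
  | 0 => [0]
  | 1 => [1, 2, 4, 8, 16, 32, 64, 128, 256, 512, 1024]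
  | 2 => [3, 5, 9, 17, 33, 6, 10, 18, 34, 66, 12, 20, 36, 68, 132, 24, 40, 72, 136, 264, 48, 80,
     144, 272, 528, 96, 160, 288, 544, 1056, 192, 320, 576, 1088, 65, 384, 640, 1152, 129,
     130, 768, 1280, 257, 258, 260, 1536, 513, 514, 516, 520, 1025, 1026, 1028, 1032, 1040]
  | 3 => [385, 1284, 1029, 1089, 133, 770, 521, 11, 131, 266, 1540, 1042, 22, 262, 532, 1033, 37,
     44, 524, 1064, 19, 74, 88, 1048, 81, 38, 148, 176, 49, 162, 76, 296, 352, 98, 324, 152,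
     592, 704, 196, 648, 304, 1184, 1408, 392, 1296, 608, 321, 769, 784, 545, 1216, 642, 1538,
     1568, 1090]
  | 4 => [1477, 907, 1814, 1581, 1115, 183, 366, 732, 1464, 881, 1762]
  | 5 => [2047]

/-- The vertex sets of the faces of a facet, indexed by the labels of the hemi-icosahedron. -/
def facetTable : List ℕ :=
  [0, 1, 4, 128, 1024, 64, 256, 5, 129, 65, 1025, 257, 132, 260, 1028, 68, 1152, 192, 384,
   1088, 1280, 320, 133, 1029, 385, 1089, 321, 196, 1284, 324, 1216, 1408, 1477]

/-- The vertex sets of the faces at a vertex, indexed by the labels of the hemi-icosahedron. -/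
def vertexTable : List ℕ :=
  [2047, 1477, 907, 183, 881, 1115, 1581, 385, 133, 1089, 321, 1029, 131, 521, 769, 11, 49,
   19, 37, 81, 545, 1033, 129, 257, 5, 65, 1025, 3, 513, 9, 17, 33, 1]

/-- The faces of the facet number `i`. -/
def facetMask (i : ℕ) (k : Fin 33) : ℕ := translate i (facetTable.getD k 0)

/-- The faces at the vertex number `i`. -/
def vertexMask (i : ℕ) (k : Fin 33) : ℕ := translate i (vertexTable.getD k 0)

/-- Inclusion of bit masks. -/
def Sub (a b : ℕ) : Prop := Nat.land a b = a

instance (a b : ℕ) : Decidable (Sub a b) := Nat.decEq _ _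

theorem rank_lt_of_sub : ∀ r s : Fin 6, ∀ a ∈ cells r, ∀ b ∈ cells s, Sub a b →
    a = b ∧ r = s ∨ r < s := by
  decide +kernel

theorem exists_between : ∀ r i s : Fin 6, r < i → i < s → ∀ a ∈ cells r, ∀ b ∈ cells s, Sub a b →
    ∃ c ∈ cells i, Sub a c ∧ Sub c b := by
  decide +kernel

theorem diamond_cells : ∀ r s t : Fin 6, (s : ℕ) = r + 1 → (t : ℕ) = s + 1 →
    ∀ a ∈ cells r, ∀ b ∈ cells t, Sub a b →
    ((cells s).filter fun c => Sub a c ∧ Sub c b).length = 2 := by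
  decide +kernel

theorem nodup_cells : ∀ r, (cells r).Nodup := by
  decide +kernel

/-- The faces `x` and `y` of rank `p - 1` between `a` and `b` are joined by a sequence
`x, t, z, t', y` of incident faces between `a` and `b`, with `z` of rank `p - 1` and `t`, `t'` of
rank `q - 1`. -/
def Linked (p q : Fin 6) (a b x y : ℕ) : Prop :=
  ∃ z ∈ y :: cells p, Sub a z ∧ Sub z b ∧
    (∃ t ∈ cells q, Sub x t ∧ Sub z t ∧ Sub t b) ∧
    (∃ t ∈ cells q, Sub z t ∧ Sub y t ∧ Sub t b)

instance (p q : Fin 6) (a b x y : ℕ) : Decidable (Linked p q a b x y) :=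
  inferInstanceAs (Decidable (∃ _ ∈ _, _))

set_option synthInstance.maxSize 1000 in
theorem linked_cells : ∀ p' p : Fin 6, (p : ℕ) = p' + 1 → ∀ q q' : Fin 6, p < q →
    (q' : ℕ) = q + 1 → ∀ a ∈ cells p', ∀ b ∈ cells q', Sub a b →
    ∀ x ∈ cells p, Sub a x → Sub x b → ∀ y ∈ cells p, Sub a y → Sub y b →
    Linked p q a b x y := by
  decide +kernel

theorem cells_one : ∀ a ∈ cells 1, ∃ i < 11, a = vertexMask i 32 := by
  decide +kernel

theorem cells_four : ∀ a ∈ cells 4, ∃ i < 11, a = facetMask i 32 := by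
  decide +kernel

theorem facetMask_sub : ∀ i < 11, ∀ k l,
    Sub (facetMask i k) (facetMask i l) ↔ HemiIcosa.Sub k l := by
  decide +kernel

theorem vertexMask_sub : ∀ i < 11, ∀ k l,
    Sub (vertexMask i l) (vertexMask i k) ↔ HemiIcosa.Sub k l := by
  decide +kernel

theorem exists_facetMask : ∀ i < 11, ∀ r, ∀ a ∈ cells r, Sub a (facetMask i 32) →
    ∃ k, facetMask i k = a := by
  decide +kernel

theorem exists_vertexMask : ∀ i < 11, ∀ r, ∀ a ∈ cells r, Sub (vertexMask i 32) a →
    ∃ k, vertexMask i k = a := by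
  decide +kernel

theorem facetMask_mem : ∀ i < 11, ∀ k, ∃ r, facetMask i k ∈ cells r := by
  decide +kernel

theorem vertexMask_mem : ∀ i < 11, ∀ k, ∃ r, vertexMask i k ∈ cells r := by
  decide +kernel

theorem length_cells_four : (cells 4).length = 11 := by
  decide +kernel

end ElevenCell

/-! ### Flags as sequences of faces -/

/-- A flag of a poset with rank function, given as the sequence of its faces. -/
@[ext] structure FlagSeq {α : Type*} [PartialOrder α] (rank : α → ℤ) where
  /-- the face of rank `i - 1` -/
  face : Fin 6 → α
  face_lt : ∀ i : Fin 5, face i.castSucc < face i.succ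
  rank_face : ∀ i, rank (face i) = (i : ℕ) - 1

/-- A bounded poset whose maximal chains have a face of each rank from `-1` to `4`. -/
structure Graded {α : Type*} [PartialOrder α] (rank : α → ℤ) : Prop where
  strictMono : StrictMono rank
  mem : ∀ x, rank x ∈ Set.Icc (-1 : ℤ) 4
  flag : ∀ c : Set α, IsMaxChain (· ≤ ·) c →
    ∀ i ∈ Set.Icc (-1 : ℤ) 4, ∃! F, F ∈ c ∧ rank F = i

namespace FlagSeq

variable {α : Type*} [PartialOrder α] {rank : α → ℤ}

theorem strictMono (f : FlagSeq rank) : StrictMono f.face := Fin.strictMono_iff_lt_succ.2 f.face_lt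

theorem face_inj {f g : FlagSeq rank} {i j : Fin 6} (h : f.face i = g.face j) : i = j := by
  have := congrArg rank h
  rw [f.rank_face, g.rank_face] at this
  omega

/-- Two flags are `j`-adjacent if they differ exactly in their faces at position `j`. -/
def Adj (j : Fin 6) (f g : FlagSeq rank) : Prop :=
  f.face j ≠ g.face j ∧ ∀ i, i ≠ j → f.face i = g.face i

theorem Adj.symm {j : Fin 6} {f g : FlagSeq rank} (h : Adj j f g) : Adj j g f :=
  ⟨h.1.symm, fun i hi => (h.2 i hi).symm⟩

/-- Two flags are joined by a sequence of flags, changing only faces at positions in `I`. -/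
def Conn (I : Set (Fin 6)) : FlagSeq rank → FlagSeq rank → Prop :=
  Relation.ReflTransGen fun f g => ∃ j ∈ I, Adj j f g

theorem Conn.mono {I J : Set (Fin 6)} (hIJ : I ⊆ J) {f g : FlagSeq rank} (h : Conn I f g) :
    Conn J f g :=
  Relation.ReflTransGen.mono (fun _ _ ⟨j, hj, h⟩ => ⟨j, hIJ hj, h⟩) _ _ h

theorem Conn.face_eq {I : Set (Fin 6)} {f g : FlagSeq rank} (h : Conn I f g) {i : Fin 6}
    (hi : i ∉ I) : f.face i = g.face i := by
  induction h with
  | refl => rfl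
  | tail _ h ih =>
    obtain ⟨j, hj, h⟩ := h
    exact ih.trans (h.2 i fun hij => hi (hij ▸ hj))

theorem exists_face (hr : Graded rank) (f : FlagSeq rank) (x : α) :
    ∃ i, rank (f.face i) = rank x := by
  obtain ⟨h1, h2⟩ := hr.mem x
  refine ⟨⟨(rank x + 1).toNat, by omega⟩, ?_⟩
  rw [f.rank_face]
  simp only
  omega

theorem isMaxChain (hr : Graded rank) (f : FlagSeq rank) :
    IsMaxChain (· ≤ ·) (Set.range f.face) := by
  refine ⟨?_, fun t ht hft => Set.Subset.antisymm hft fun x hx => ?_⟩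
  · rintro _ ⟨i, rfl⟩ _ ⟨j, rfl⟩ -
    exact (le_total i j).imp (fun h => f.strictMono.monotone h) (fun h => f.strictMono.monotone h)
  · obtain ⟨i, hi⟩ := f.exists_face hr x
    refine ⟨i, by_contra fun hne => ?_⟩
    rcases ht (hft ⟨i, rfl⟩) hx hne with h | h
    · exact (hr.strictMono (h.lt_of_ne hne)).ne hi
    · exact (hr.strictMono (h.lt_of_ne' hne)).ne' hi

theorem exists_of_isMaxChain (hr : Graded rank) {c : Set α} (hc : IsMaxChain (· ≤ ·) c) :
    ∃ f : FlagSeq rank, Set.range f.face = c := by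
  have h (i : Fin 6) : ∃ F, F ∈ c ∧ rank F = (i : ℕ) - 1 :=
    (hr.flag c hc _ ⟨by omega, by omega⟩).exists
  choose F hF hrank using h
  refine ⟨⟨F, fun i => ?_, hrank⟩, ?_⟩
  · have hlt : rank (F i.castSucc) < rank (F i.succ) := by simp [hrank]
    rcases hc.1.total (hF i.castSucc) (hF i.succ) with h | h
    · exact h.lt_of_ne fun h => hlt.ne (congrArg rank h)
    · exact absurd (hr.strictMono.monotone h) hlt.not_ge
  · refine Set.Subset.antisymm (Set.range_subset_iff.2 hF) fun x hx => ?_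
    obtain ⟨h1, h2⟩ := hr.mem x
    have hx' : rank (F ⟨(rank x + 1).toNat, by omega⟩) = rank x := by
      rw [hrank]; simp only; omega
    exact ⟨_, (hr.flag c hc _ (hr.mem x)).unique ⟨hF _, hx'⟩ ⟨hx, rfl⟩⟩

theorem face_eq_of_mem_range {f : FlagSeq rank} {x : α} {i : Fin 6}
    (hx : x ∈ Set.range f.face) (hi : rank x = (i : ℕ) - 1) : f.face i = x := by
  obtain ⟨k, rfl⟩ := hx
  rw [f.rank_face] at hi
  congr 1
  omega

/-- Every chain is contained in a flag. -/
theorem exists_of_isChain (hr : Graded rank) {s : Set α} (hs : IsChain (· ≤ ·) s) :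
    ∃ f : FlagSeq rank, s ⊆ Set.range f.face := by
  obtain ⟨c, hc, hsc⟩ := hs.exists_maxChain
  obtain ⟨f, rfl⟩ := exists_of_isMaxChain hr hc
  exact ⟨f, hsc⟩

theorem ext_range {f g : FlagSeq rank} (h : Set.range f.face = Set.range g.face) : f = g :=
  FlagSeq.ext <| funext fun i =>
    (face_eq_of_mem_range (h ▸ Set.mem_range_self i) (f.rank_face i)).symm

theorem adj_iff {f g : FlagSeq rank} : (∃ j, Adj j f g) ↔
    ∃ F G, Set.range f.face \ Set.range g.face = {F} ∧
      Set.range g.face \ Set.range f.face = {G} := by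
  constructor
  · rintro ⟨j, h⟩
    have key {f g : FlagSeq rank} (h : Adj j f g) :
        Set.range f.face \ Set.range g.face = {f.face j} := by
      ext x
      constructor
      · rintro ⟨⟨i, rfl⟩, hi⟩
        by_cases hij : i = j
        · rw [hij]; rfl
        · exact absurd ⟨i, (h.2 i hij).symm⟩ hi
      · rintro rfl
        exact ⟨⟨j, rfl⟩, fun ⟨i, hi⟩ => h.1 (face_inj hi ▸ hi).symm⟩
    exact ⟨_, _, key h, key h.symm⟩
  · rintro ⟨F, G, hF, -⟩
    have hF' : F ∈ Set.range f.face \ Set.range g.face := hF ▸ rfl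
    obtain ⟨⟨j, rfl⟩, hj⟩ := hF'
    refine ⟨j, fun h => hj ⟨j, h.symm⟩, fun i hij => by_contra fun hne => hij ?_⟩
    have : f.face i ∈ Set.range f.face \ Set.range g.face :=
      ⟨⟨i, rfl⟩, fun ⟨k, hk⟩ => hne (face_inj hk ▸ hk).symm⟩
    rw [hF] at this
    exact face_inj this

end FlagSeq

namespace FlagSeq

variable {α : Type*} [PartialOrder α] {rank : α → ℤ}

/-- Strong flag-connectivity in terms of sequences implies that for maximal chains. -/
theorem connected_of_conn (hr : Graded rank)
    (hconn : ∀ f g : FlagSeq rank, Conn {j | f.face j ≠ g.face j} f g) (c d : Set α)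
    (hc : IsMaxChain (· ≤ ·) c) (hd : IsMaxChain (· ≤ ·) d) :
    Relation.ReflTransGen (fun x y : Set α => IsMaxChain (· ≤ ·) y ∧ c ∩ d ⊆ y ∧
      (∃ F G : α, x \ y = {F} ∧ y \ x = {G})) c d := by
  obtain ⟨f, rfl⟩ := exists_of_isMaxChain hr hc
  obtain ⟨g, rfl⟩ := exists_of_isMaxChain hr hd
  suffices ∀ h : FlagSeq rank, Conn {j | f.face j ≠ g.face j} f h →
      Relation.ReflTransGen (fun x y : Set α => IsMaxChain (· ≤ ·) y ∧
        Set.range f.face ∩ Set.range g.face ⊆ y ∧ (∃ F G : α, x \ y = {F} ∧ y \ x = {G}))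
        (Set.range f.face) (Set.range h.face) from this g (hconn f g)
  intro h hfh
  induction hfh with
  | refl => exact .refl
  | tail hfh hstep ih =>
    rename_i h h'
    refine ih.tail ⟨h'.isMaxChain hr, ?_, adj_iff.1 (hstep.imp fun _ h => h.2)⟩
    rintro _ ⟨⟨i, rfl⟩, k, hk⟩
    obtain rfl := face_inj hk
    exact ⟨k, ((Conn.face_eq (.tail hfh hstep)) (not_not.2 hk.symm)).symm⟩

/-- Strong flag-connectivity of maximal chains implies that for sequences. -/
theorem conn_of_connected (hr : Graded rank) {f g : FlagSeq rank}
    (h : Relation.ReflTransGen (fun x y : Set α => IsMaxChain (· ≤ ·) y ∧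
      Set.range f.face ∩ Set.range g.face ⊆ y ∧ (∃ F G : α, x \ y = {F} ∧ y \ x = {G}))
      (Set.range f.face) (Set.range g.face)) : Conn {j | f.face j ≠ g.face j} f g := by
  suffices ∀ c, Relation.ReflTransGen (fun x y : Set α => IsMaxChain (· ≤ ·) y ∧
      Set.range f.face ∩ Set.range g.face ⊆ y ∧ (∃ F G : α, x \ y = {F} ∧ y \ x = {G}))
      (Set.range f.face) c →
      ∃ h, Set.range h.face = c ∧ Conn {j | f.face j ≠ g.face j} f h by
    obtain ⟨h, hg, hfh⟩ := this _ h
    rwa [ext_range hg] at hfh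
  intro c hc
  induction hc with
  | refl => exact ⟨f, rfl, .refl⟩
  | tail _ hstep ih =>
    obtain ⟨h, rfl, hfh⟩ := ih
    obtain ⟨hmax, hsub, hFG⟩ := hstep
    obtain ⟨h', rfl⟩ := exists_of_isMaxChain hr hmax
    obtain ⟨j, hj⟩ := adj_iff.2 hFG
    refine ⟨h', rfl, hfh.tail ⟨j, fun hfg => hj.1 ?_, hj⟩⟩
    rw [← hfh.face_eq (not_not.2 hfg)]
    exact (face_eq_of_mem_range (hsub ⟨⟨j, rfl⟩, ⟨j, hfg.symm⟩⟩) (f.rank_face j)).symm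

end FlagSeq

namespace ElevenCell

theorem Sub.trans {a b c : ℕ} (hab : Sub a b) (hbc : Sub b c) : Sub a c := by
  unfold Sub at *
  rw [← hab, show Nat.land (Nat.land a b) c = Nat.land a (Nat.land b c) from Nat.land_assoc a b c,
    hbc]

/-- The faces of the 11-cell. -/
structure Cell : Type u where
  /-- the position of the face in a flag -/
  idx : Fin 6
  /-- the vertex set -/
  mask : ℕ
  mem : mask ∈ cells idx

namespace Cell

theorem ext_mask {x y : Cell} (hi : x.idx = y.idx) (h : x.mask = y.mask) : x = y := by
  cases x; cases y; simp_all

instance : PartialOrder Cell.{u} where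
  le x y := Sub x.mask y.mask
  le_refl x := Nat.and_self x.mask
  le_trans _ _ _ := Sub.trans
  le_antisymm x y hxy hyx := by
    rcases rank_lt_of_sub _ _ _ x.mem _ y.mem hxy with h | h
    · exact ext_mask h.2 h.1
    · rcases rank_lt_of_sub _ _ _ y.mem _ x.mem hyx with h' | h'
      · exact ext_mask h'.2.symm h'.1.symm
      · exact absurd h h'.asymm

theorem le_def {x y : Cell.{u}} : x ≤ y ↔ Sub x.mask y.mask := Iff.rfl

theorem idx_lt {x y : Cell.{u}} (h : x < y) : x.idx < y.idx := by
  rcases rank_lt_of_sub _ _ _ x.mem _ y.mem h.le with h' | h'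
  · exact absurd (ext_mask h'.2 h'.1) h.ne
  · exact h'

theorem lt_iff {x y : Cell.{u}} : x < y ↔ x.idx < y.idx ∧ Sub x.mask y.mask :=
  ⟨fun h => ⟨idx_lt h, h.le⟩, fun h => lt_of_le_of_ne h.2 fun h' => h.1.ne (congrArg _ h')⟩

instance : BoundedOrder Cell.{u} where
  bot := ⟨0, 0, by decide⟩
  bot_le x := Nat.zero_and x.mask
  top := ⟨5, 2047, by decide⟩
  le_top x := (by decide +kernel : ∀ r, ∀ a ∈ cells r, Sub a 2047) _ _ x.mem

theorem bot_idx : (⊥ : Cell.{u}).idx = 0 := rfl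

theorem top_idx : (⊤ : Cell.{u}).idx = 5 := rfl

/-- The rank function of the 11-cell. -/
def rank (x : Cell.{u}) : ℤ := (x.idx : ℕ) - 1

theorem rank_strictMono : StrictMono rank.{u} := fun x y h => by
  have : (x.idx : ℕ) < y.idx := idx_lt h
  unfold rank
  omega

theorem exists_mem_idx {c : Set Cell.{u}} (hc : IsMaxChain (· ≤ ·) c) (i : Fin 6) :
    ∃ x ∈ c, x.idx = i := by
  by_contra! hi
  have hbot : (⊥ : Cell.{u}) ∈ c := hc.bot_mem
  have htop : (⊤ : Cell.{u}) ∈ c := hc.top_mem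
  have h0 : 0 < i := Fin.pos_of_ne_zero (hi _ hbot).symm
  have h5 : i < 5 := lt_of_le_of_ne (Fin.le_last i) (hi _ htop).symm
  obtain ⟨_, ⟨F, ⟨hF, hFi⟩, rfl⟩, hmax⟩ := Set.exists_max_image (idx '' {x ∈ c | x.idx < i}) id
    (Set.toFinite _) ⟨_, _, ⟨hbot, h0⟩, rfl⟩
  obtain ⟨_, ⟨G, ⟨hG, hGi⟩, rfl⟩, hmin⟩ := Set.exists_min_image (idx '' {x ∈ c | i < x.idx}) id
    (Set.toFinite _) ⟨_, _, ⟨htop, h5⟩, rfl⟩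
  have hle {x y : Cell.{u}} (hx : x ∈ c) (hy : y ∈ c) (h : x.idx ≤ y.idx) : x ≤ y := by
    rcases hc.1.total hx hy with h' | h'
    · exact h'
    · rcases h'.eq_or_lt with h' | h'
      · exact h'.ge
      · exact absurd (idx_lt h') h.not_gt
  obtain ⟨m, hm, hFm, hmG⟩ := exists_between _ i _ hFi hGi _ F.mem _ G.mem
    (hle hF hG (hFi.trans hGi).le)
  have hins : IsChain (· ≤ ·) (insert (⟨i, m, hm⟩ : Cell.{u}) c) := by
    refine hc.1.insert fun x hx _ => ?_
    rcases lt_or_gt_of_ne (hi x hx) with h | h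
    · exact .inr ((hle hx hF (hmax _ ⟨x, ⟨hx, h⟩, rfl⟩)).trans hFm)
    · exact .inl (le_trans (b := G) hmG (hle hG hx (hmin _ ⟨x, ⟨hx, h⟩, rfl⟩)))
  exact hi ⟨i, m, hm⟩ (hc.2 hins (Set.subset_insert _ _) ▸ Set.mem_insert _ _) rfl

theorem graded : Graded rank.{u} where
  strictMono := rank_strictMono
  mem x := by
    have := x.idx.isLt
    constructor <;> unfold rank <;> omega
  flag c hc i hi := by
    obtain ⟨x, hx, hxi⟩ := exists_mem_idx hc ⟨(i + 1).toNat, by have := hi.2; omega⟩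
    have hr : x.rank = i := by
      have := hi.1
      rw [rank, hxi]
      simp only
      omega
    refine ⟨x, ⟨hx, hr⟩, fun y ⟨hy, hyi⟩ => by_contra fun hne => ?_⟩
    rcases hc.1 hy hx hne with h | h
    · exact (rank_strictMono (h.lt_of_ne hne)).ne (hyi.trans hr.symm)
    · exact (rank_strictMono (h.lt_of_ne' hne)).ne (hr.trans hyi.symm)

theorem diamond (F G : Cell.{u}) (hFG : F < G) (h : G.rank = F.rank + 2) :
    ∃ H₁ H₂ : Cell.{u}, H₁ ≠ H₂ ∧ ∀ H, (F < H ∧ H < G) ↔ (H = H₁ ∨ H = H₂) := by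
  unfold rank at h
  have hlt : (F.idx : ℕ) + 1 < 6 := by omega
  let s : Fin 6 := ⟨F.idx + 1, hlt⟩
  have hs : (s : ℕ) = F.idx + 1 := rfl
  obtain ⟨a, b, hab⟩ := List.length_eq_two.1
    (diamond_cells F.idx s G.idx rfl (by omega) _ F.mem _ G.mem hFG.le)
  have hnodup : [a, b].Nodup := hab ▸ (nodup_cells s).filter _
  have hmem (m : ℕ) : (m ∈ cells s ∧ Sub F.mask m ∧ Sub m G.mask) ↔ (m = a ∨ m = b) := by
    rw [← List.mem_pair, ← hab]
    simp
  refine ⟨⟨s, a, ((hmem a).2 (.inl rfl)).1⟩, ⟨s, b, ((hmem b).2 (.inr rfl)).1⟩, ?_, fun H => ?_⟩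
  · rw [ne_eq, mk.injEq]
    rintro ⟨-, rfl⟩
    simp at hnodup
  · constructor
    · rintro ⟨h1, h2⟩
      have hH : H.idx = s := by
        have := idx_lt h1
        have := idx_lt h2
        omega
      exact ((hmem H.mask).1 ⟨hH ▸ H.mem, h1.le, h2.le⟩).imp (ext_mask hH) (ext_mask hH)
    · intro hH
      have key : H.idx = s ∧ Sub F.mask H.mask ∧ Sub H.mask G.mask := by
        rcases hH with rfl | rfl
        · exact ⟨rfl, ((hmem a).2 (.inl rfl)).2⟩
        · exact ⟨rfl, ((hmem b).2 (.inr rfl)).2⟩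
      rw [lt_iff, lt_iff, key.1]
      exact ⟨⟨by omega, key.2.1⟩, by omega, key.2.2⟩

end Cell

end ElevenCell

namespace FlagSeq

variable {α : Type*} [PartialOrder α] {rank : α → ℤ}

theorem conn_singleton {f g : FlagSeq rank} {p : Fin 6} (h : ∀ i, i ≠ p → f.face i = g.face i) :
    Conn {p} f g := by
  by_cases hp : f.face p = g.face p
  · rw [FlagSeq.ext (funext fun i => if hi : i = p then hi ▸ hp else h i hi) (x := f) (y := g)]
    exact .refl
  · exact .single ⟨p, rfl, hp, h⟩

/-- The faces of a flag at two positions, and between them, may be replaced. -/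
theorem exists_replace (hr : Graded rank) (f : FlagSeq rank) {p q : Fin 6} {x t : α}
    (hx : rank x = (p : ℕ) - 1) (ht : rank t = (q : ℕ) - 1) (hxt : x ≤ t)
    (hfx : ∀ i < p, f.face i ≤ x) (htf : ∀ i, q < i → t ≤ f.face i) :
    ∃ h : FlagSeq rank, (∀ i, i < p ∨ q < i → h.face i = f.face i) ∧
      h.face p = x ∧ h.face q = t := by
  have hchain : IsChain (· ≤ ·) (insert x (insert t (f.face '' {i | i < p ∨ q < i}))) := by
    refine (IsChain.insert ((f.isMaxChain hr).1.mono (Set.image_subset_range _ _)) ?_).insert ?_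
    · rintro _ ⟨i, hi | hi, rfl⟩ -
      · exact .inr ((hfx i hi).trans hxt)
      · exact .inl (htf i hi)
    · rintro _ (rfl | ⟨i, hi | hi, rfl⟩) -
      · exact .inl hxt
      · exact .inr (hfx i hi)
      · exact .inl (hxt.trans (htf i hi))
  obtain ⟨h, hh⟩ := exists_of_isChain hr hchain
  exact ⟨h, fun i hi => face_eq_of_mem_range (hh (.inr (.inr ⟨i, hi, rfl⟩))) (f.rank_face i),
    face_eq_of_mem_range (hh (.inl rfl)) hx, face_eq_of_mem_range (hh (.inr (.inl rfl))) ht⟩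

/-- Two flags with a common face can be combined. -/
theorem exists_mix (f g : FlagSeq rank) {k : Fin 6} (hk : f.face k = g.face k) :
    ∃ h : FlagSeq rank, (∀ i ≤ k, h.face i = f.face i) ∧ ∀ i, k ≤ i → h.face i = g.face i := by
  refine ⟨⟨fun i => if i ≤ k then f.face i else g.face i, fun i => ?_, fun i => ?_⟩,
    fun i hi => if_pos hi, fun i hi => ?_⟩
  · have hi := i.castSucc_lt_succ
    split_ifs with h1 h2 h2
    · exact f.face_lt i
    · obtain rfl : i.castSucc = k := by
        refine le_antisymm h1 ?_
        rw [Fin.le_def]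
        rw [Fin.le_def, Fin.val_succ] at h2
        rw [Fin.val_castSucc]
        omega
      rw [hk]
      exact g.face_lt i
    · exact absurd (hi.le.trans h2) h1
    · exact g.face_lt i
  · split_ifs
    · exact f.rank_face i
    · exact g.rank_face i
  · rcases hi.eq_or_lt with rfl | hi
    · exact (if_pos le_rfl).trans hk
    · exact if_neg hi.not_ge

/-- A flag-connectivity criterion for all sections from that for intervals. -/
theorem conn_of_conn_Icc (hIcc : ∀ p q : Fin 6, 0 < p → q < 5 → ∀ f g : FlagSeq rank,
      (∀ i, i < p ∨ q < i → f.face i = g.face i) → Conn (Set.Icc p q) f g)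
    (h0 : ∀ f g : FlagSeq rank, f.face 0 = g.face 0)
    (h5 : ∀ f g : FlagSeq rank, f.face 5 = g.face 5) (f g : FlagSeq rank) :
    Conn {j | f.face j ≠ g.face j} f g := by
  suffices ∀ n, ∀ f g : FlagSeq rank, (∀ i : Fin 6, n ≤ (i : ℕ) → f.face i = g.face i) →
      Conn {j | f.face j ≠ g.face j} f g from
    this 6 f g fun i hi => absurd i.isLt hi.not_gt
  intro n
  induction n with
  | zero =>
    intro f g h
    rw [FlagSeq.ext (funext fun i => h i (Nat.zero_le _)) (x := f) (y := g)]
    exact .refl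
  | succ m ih =>
    intro f g h
    by_cases hm : ∀ i : Fin 6, (i : ℕ) = m → f.face i = g.face i
    · refine ih f g fun i hi => ?_
      rcases hi.eq_or_lt with hi | hi
      · exact hm i hi.symm
      · exact h i hi
    · push Not at hm
      obtain ⟨q, rfl, hq⟩ := hm
      obtain ⟨k, ⟨hkq, hk⟩, hmax⟩ := Set.exists_max_image
        {i : Fin 6 | i < q ∧ f.face i = g.face i} id (Set.toFinite _)
        ⟨0, Fin.pos_of_ne_zero fun h => hq (h ▸ h0 f g), h0 f g⟩
      have hq5 : q < 5 := lt_of_le_of_ne (Fin.le_last q) fun h => hq (h ▸ h5 f g)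
      obtain ⟨e, he1, he2⟩ := exists_mix f g hk
      have hkv : (k : ℕ) < q := hkq
      let p : Fin 6 := ⟨k + 1, by omega⟩
      have hp : (p : ℕ) = k + 1 := rfl
      have hne : ∀ i, p ≤ i → i ≤ q → f.face i ≠ g.face i := by
        intro i h1 h2 h3
        rcases h2.eq_or_lt with rfl | h2
        · exact hq h3
        · have : i ≤ k := hmax i ⟨h2, h3⟩
          rw [Fin.le_def] at *
          omega
      have h1 : Conn (Set.Icc p q) f e := by
        refine hIcc p q (by rw [Fin.lt_def, hp]; exact Nat.succ_pos _) hq5 f e fun i hi => ?_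
        rcases hi with hi | hi
        · exact (he1 i (by rw [Fin.le_def]; rw [Fin.lt_def] at hi; omega)).symm
        · rw [he2 i (hkq.le.trans hi.le)]
          exact h i hi
      have h2 := ih e g fun i hi => he2 i (hkq.le.trans hi)
      refine (h1.mono fun i hi => hne i hi.1 hi.2).trans (h2.mono fun i hi => ?_)
      rcases le_total i k with hik | hik
      · rw [Set.mem_ofPred_eq, he1 i hik] at hi
        exact hi
      · exact absurd (he2 i hik) hi

end FlagSeq

namespace ElevenCell

namespace Cell

open FlagSeq

theorem idx_face (f : FlagSeq Cell.rank.{u}) (i : Fin 6) : (f.face i).idx = i := by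
  have := f.rank_face i
  unfold rank at this
  omega

theorem face_mem (f : FlagSeq Cell.rank.{u}) (i : Fin 6) : (f.face i).mask ∈ cells i := by
  have := (f.face i).mem
  rwa [idx_face] at this

theorem face_zero (f : FlagSeq Cell.rank.{u}) : f.face 0 = ⊥ :=
  (eq_bot_or_bot_lt _).resolve_right fun h => by simpa [bot_idx, idx_face] using idx_lt h

theorem face_five (f : FlagSeq Cell.rank.{u}) : f.face 5 = ⊤ :=
  (eq_top_or_lt_top _).resolve_right fun h => by simpa [top_idx, idx_face] using idx_lt h

theorem conn_of_le {p q : Fin 6} (hpq : p < q)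
    (h1 : ∀ f g : FlagSeq Cell.rank.{u}, (∀ i, i ≤ p ∨ q < i → f.face i = g.face i) →
      Conn (Set.Icc p q) f g)
    (h2 : ∀ f g : FlagSeq Cell.rank.{u}, (∀ i, i < p ∨ q ≤ i → f.face i = g.face i) →
      Conn (Set.Icc p q) f g)
    (f g : FlagSeq Cell.rank.{u}) (h : ∀ i, i < p ∨ q < i → f.face i = g.face i)
    {t : Cell.{u}} (ht : t.idx = q) (hft : f.face p ≤ t) (hgt : g.face p ≤ t)
    (htf : ∀ i, q < i → t ≤ f.face i) : Conn (Set.Icc p q) f g := by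
  have ht' : t.rank = (q : ℕ) - 1 := by rw [rank, ht]
  obtain ⟨a, ha, hap, haq⟩ := exists_replace graded f (f.rank_face p) ht' hft
    (fun i hi => f.strictMono.monotone hi.le) htf
  obtain ⟨b, hb, hbp, hbq⟩ := exists_replace graded g (g.rank_face p) ht' hgt
    (fun i hi => g.strictMono.monotone hi.le) fun i hi => h i (.inr hi) ▸ htf i hi
  refine (h1 f a ?_).trans ((h2 a b ?_).trans (h1 b g ?_))
  · rintro i (hi | hi)
    · rcases hi.eq_or_lt with rfl | hi
      · exact hap.symm
      · exact (ha i (.inl hi)).symm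
    · exact (ha i (.inr hi)).symm
  · rintro i (hi | hi)
    · rw [ha i (.inl hi), hb i (.inl hi), h i (.inl hi)]
    · rcases hi.eq_or_lt with rfl | hi
      · rw [haq, hbq]
      · rw [ha i (.inr hi), hb i (.inr hi), h i (.inr hi)]
  · rintro i (hi | hi)
    · rcases hi.eq_or_lt with rfl | hi
      · exact hbp
      · exact hb i (.inl hi)
    · exact hb i (.inr hi)

theorem conn_Icc (p q : Fin 6) (hp : 0 < p) (hq : q < 5) (f g : FlagSeq Cell.rank.{u})
    (h : ∀ i, i < p ∨ q < i → f.face i = g.face i) : Conn (Set.Icc p q) f g := by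
  rcases lt_trichotomy q p with hqp | rfl | hpq
  · refine Conn.mono (Set.empty_subset _) ?_
    rw [FlagSeq.ext (funext fun i => h i ((lt_or_ge i p).imp_right hqp.trans_le)) (x := f) (y := g)]
    exact .refl
  · exact (conn_singleton fun i hi => h i (lt_or_gt_of_ne hi)).mono (by simp)
  · have hp' : (0 : ℕ) < p := hp
    have hq' : (q : ℕ) < 5 := hq
    have hpq' : (p : ℕ) < q := hpq
    let p₀ : Fin 6 := ⟨p - 1, by omega⟩
    let p₁ : Fin 6 := ⟨p + 1, by omega⟩
    let q₀ : Fin 6 := ⟨q - 1, by omega⟩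
    let q₁ : Fin 6 := ⟨q + 1, by omega⟩
    have h1 (f g : FlagSeq Cell.rank.{u}) (h : ∀ i, i ≤ p ∨ q < i → f.face i = g.face i) :
        Conn (Set.Icc p q) f g := by
      refine (conn_Icc p₁ q (Nat.succ_pos _) hq f g fun i hi => h i (hi.imp_left ?_)).mono
        (Set.Icc_subset_Icc_left (Nat.le_succ _))
      exact Nat.le_of_lt_succ
    have h2 (f g : FlagSeq Cell.rank.{u}) (h : ∀ i, i < p ∨ q ≤ i → f.face i = g.face i) :
        Conn (Set.Icc p q) f g := by
      have hq₀ : q₀ < 5 := by rw [Fin.lt_def]; change (q : ℕ) - 1 < 5; omega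
      refine (conn_Icc p q₀ hp hq₀ f g fun i hi => h i (hi.imp_right ?_)).mono
        (Set.Icc_subset_Icc_right (Nat.sub_le _ _))
      exact Nat.le_of_pred_lt
    have hp₀ : p₀ < p := by rw [Fin.lt_def]; change (p : ℕ) - 1 < p; omega
    have hq₁ : q < q₁ := Nat.lt_succ_self _
    have hle (f : FlagSeq Cell.rank.{u}) {i j : Fin 6} (hij : i ≤ j) :
      Sub (f.face i).mask (f.face j).mask := f.strictMono.monotone hij
    obtain ⟨z, hz, haz, hzb, ⟨t, ht, hxt, hzt, htb⟩, ⟨t', ht', hzt', hyt', htb'⟩⟩ :=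
      linked_cells p₀ p (by change (p : ℕ) = p - 1 + 1; omega) q q₁ hpq rfl
        _ (face_mem f p₀) _ (face_mem f q₁) (hle f (by omega))
        _ (face_mem f p) (hle f hp₀.le) (hle f (by omega))
        _ (face_mem g p) (h p₀ (.inl hp₀) ▸ hle g hp₀.le)
        (h q₁ (.inr hq₁) ▸ hle g (by omega))
    replace hz : z ∈ cells p := (List.mem_cons.1 hz).elim (fun h => h ▸ face_mem g p) id
    have hup {t : ℕ} (htb : Sub t (f.face q₁).mask) (i : Fin 6) (hi : q < i) :
        Sub t (f.face i).mask := htb.trans (hle f hi)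
    obtain ⟨w, hw, hwp, hwq⟩ := exists_replace graded f (x := ⟨p, z, hz⟩) (t := ⟨q, t, ht⟩)
      rfl rfl hzt (fun i hi => (hle f (Nat.le_sub_one_of_lt hi : i ≤ p₀)).trans haz) (hup htb)
    refine (conn_of_le hpq h1 h2 f w (fun i hi => (hw i hi).symm) (t := ⟨q, t, ht⟩) rfl hxt
      (hwp ▸ hzt) (hup htb)).trans
      (conn_of_le hpq h1 h2 w g (fun i hi => (hw i hi).trans (h i hi)) (t := ⟨q, t', ht'⟩) rfl
      (hwp ▸ hzt') hyt' fun i hi => hw i (.inr hi) ▸ hup htb' i hi)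
termination_by (q : ℕ) - p
decreasing_by
  · omega
  · omega

theorem connected (c d : Set Cell.{u}) (hc : IsMaxChain (· ≤ ·) c) (hd : IsMaxChain (· ≤ ·) d) :
    Relation.ReflTransGen (fun x y : Set Cell.{u} => IsMaxChain (· ≤ ·) y ∧ c ∩ d ⊆ y ∧
      (∃ F G, x \ y = {F} ∧ y \ x = {G})) c d :=
  connected_of_conn graded (conn_of_conn_Icc conn_Icc
    (fun f g => (face_zero f).trans (face_zero g).symm)
    fun f g => (face_five f).trans (face_five g).symm) c d hc hd

end Cell

/-- The 11-cell. -/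
def polytope : APolytope.{u} 4 where
  α := Cell.{u}
  rank := Cell.rank
  rank_bot := rfl
  rank_top := rfl
  rank_strictMono := Cell.rank_strictMono
  rank_mem := Cell.graded.mem
  flag_ranks := Cell.graded.flag
  diamond := Cell.diamond
  connected := Cell.connected

end ElevenCell

/-! ### Labels for the faces of the hemi-icosahedron -/

namespace HemiIcosa

/-- The label of a face of the hemi-icosahedron. -/
def label (S : Finset (Fin 33)) : Fin 33 :=
  (List.finRange 33).foldl (fun a k => if k ∈ S then k else a) 0

theorem label_filter : ∀ k, label (Finset.univ.filter (Sub · k)) = k := by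
  decide +kernel

theorem data_eq :
    HemiIcosaPosetData = Finset.univ.image fun k => Finset.univ.filter (Sub · k) := by
  decide +kernel

theorem mem_iff {S : Finset (Fin 33)} (hS : S ∈ HemiIcosaPosetData) (k : Fin 33) :
    k ∈ S ↔ Sub k (label S) := by
  rw [data_eq] at hS
  obtain ⟨l, -, rfl⟩ := Finset.mem_image.1 hS
  rw [label_filter, Finset.mem_filter_univ]

theorem le_iff {S T : HemiIcosaPoset} : S ≤ T ↔ Sub (label S.1) (label T.1) := by
  constructor
  · intro h
    exact (mem_iff T.2 _).1 (h ((mem_iff S.2 _).2 (Nat.and_self _)))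
  · intro h k hk
    rw [mem_iff S.2] at hk
    rw [mem_iff T.2]
    unfold Sub at *
    rw [← hk, Nat.and_assoc, h]

theorem label_injective {S T : HemiIcosaPoset} (h : label S.1 = label T.1) : S = T :=
  le_antisymm (le_iff.2 (h ▸ Nat.and_self _)) (le_iff.2 (h ▸ Nat.and_self _))

theorem label_surjective (k : Fin 33) : ∃ S : HemiIcosaPoset, label S.1 = k := by
  have hk : Finset.univ.filter (Sub · k) ∈ HemiIcosaPosetData :=
    data_eq ▸ Finset.mem_image_of_mem _ (Finset.mem_univ k)
  exact ⟨⟨_, hk⟩, label_filter k⟩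

theorem sub_last : ∀ k, Sub k 32 := by
  decide +kernel

end HemiIcosa

namespace ElevenCell

namespace Cell

theorem exists_facetMask_eq {F : Cell.{u}} (hF : F.idx = 4) : ∃ i < 11, F.mask = facetMask i 32 :=
  cells_four _ (hF ▸ F.mem)

theorem exists_vertexMask_eq {F : Cell.{u}} (hF : F.idx = 1) :
    ∃ i < 11, F.mask = vertexMask i 32 :=
  cells_one _ (hF ▸ F.mem)

theorem facet_iso {F : Cell.{u}} (hF : F.idx = 4) : Nonempty (Set.Iic F ≃o HemiIcosaPoset) := by
  obtain ⟨i, hi, hFi⟩ := exists_facetMask_eq hF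
  choose r hr using facetMask_mem i hi
  let e : HemiIcosaPoset ↪o Set.Iic F := OrderEmbedding.ofMapLEIff
    (fun S => ⟨⟨r (HemiIcosa.label S.1), _, hr (HemiIcosa.label S.1)⟩, by
      rw [Set.mem_Iic, le_def, hFi, facetMask_sub i hi]
      exact HemiIcosa.sub_last _⟩)
    fun S T => (facetMask_sub i hi _ _).trans HemiIcosa.le_iff.symm
  refine ⟨(RelIso.ofSurjective e fun ⟨x, hx⟩ => ?_).symm⟩
  rw [Set.mem_Iic, le_def, hFi] at hx
  obtain ⟨k, hk⟩ := exists_facetMask i hi _ _ x.mem hx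
  obtain ⟨S, rfl⟩ := HemiIcosa.label_surjective k
  refine ⟨S, le_antisymm ?_ ?_⟩
  · change Sub (facetMask i _) x.mask
    exact hk ▸ Nat.and_self _
  · change Sub x.mask (facetMask i _)
    exact hk ▸ Nat.and_self _

theorem vertexFigure_iso {F : Cell.{u}} (hF : F.idx = 1) :
    Nonempty (Set.Ici F ≃o HemiDodecaPoset) := by
  obtain ⟨i, hi, hFi⟩ := exists_vertexMask_eq hF
  choose r hr using vertexMask_mem i hi
  let e : HemiDodecaPoset ↪o Set.Ici F := OrderEmbedding.ofMapLEIff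
    (fun S => ⟨⟨r (HemiIcosa.label S.ofDual.1), _, hr (HemiIcosa.label S.ofDual.1)⟩, by
      rw [Set.mem_Ici, le_def, hFi, vertexMask_sub i hi]
      exact HemiIcosa.sub_last _⟩)
    fun S T => (vertexMask_sub i hi _ _).trans
      (HemiIcosa.le_iff (S := T.ofDual) (T := S.ofDual)).symm
  refine ⟨(RelIso.ofSurjective e fun ⟨x, hx⟩ => ?_).symm⟩
  rw [Set.mem_Ici, le_def, hFi] at hx
  obtain ⟨k, hk⟩ := exists_vertexMask i hi _ _ x.mem hx
  obtain ⟨S, rfl⟩ := HemiIcosa.label_surjective k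
  refine ⟨OrderDual.toDual S, le_antisymm ?_ ?_⟩
  · change Sub (vertexMask i _) x.mask
    exact hk ▸ Nat.and_self _
  · change Sub x.mask (vertexMask i _)
    exact hk ▸ Nat.and_self _

end Cell

theorem facetsAre : polytope.{u}.FacetsAre HemiIcosaPoset := fun F hF =>
  Cell.facet_iso (F := F) (by
    change Cell.rank F = 3 at hF
    unfold Cell.rank at hF
    omega)

theorem vertexFiguresAre : polytope.{u}.VertexFiguresAre HemiDodecaPoset := fun F hF =>
  Cell.vertexFigure_iso (F := F) (by
    change Cell.rank F = 0 at hF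
    unfold Cell.rank at hF
    omega)

theorem card_facets : Nat.card {F : polytope.{u}.α // polytope.{u}.rank F = 3} = 11 := by
  have e : {F : Cell.{u} // F.rank = 3} ≃ {m // m ∈ (cells 4).toFinset} :=
    { toFun := fun F => ⟨F.1.mask, by
        have h := F.2
        unfold Cell.rank at h
        have h4 : F.1.idx = 4 := by omega
        exact List.mem_toFinset.2 (h4 ▸ F.1.mem)⟩
      invFun := fun m => ⟨⟨4, m.1, List.mem_toFinset.1 m.2⟩, rfl⟩
      left_inv := fun F => by
        have h := F.2
        unfold Cell.rank at h
        exact Subtype.ext (Cell.ext_mask (by omega : (4 : Fin 6) = F.1.idx) rfl)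
      right_inv := fun m => rfl }
  refine (Nat.card_congr e).trans ?_
  rw [Nat.card_eq_fintype_card, Fintype.card_coe, List.toFinset_card_of_nodup (nodup_cells 4),
    length_cells_four]

end ElevenCell

/-! ### The double coset decomposition -/

section DoubleCoset

open HemiIcosa

/-- The generators of the group of the 11-cell: `a 0`, `a 1`, `a 2` satisfy the relations of the
hemi-icosahedron, `a 3`, `a 2`, `a 1` satisfy those of the hemidodecahedron, and `a 0` commutes with
`a 3`. -/
structure ElevenCellRel {M : Type*} [Monoid M] (a : Fin 4 → M) : Prop where
  facet : ∀ u v : List (Fin 3), act refl u 0 = act refl v 0 →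
    (u.map fun j => a j.castSucc).prod = (v.map fun j => a j.castSucc).prod
  vertex : ∀ u v : List (Fin 3), act refl u 0 = act refl v 0 →
    (u.map fun j => a j.castSucc.rev).prod = (v.map fun j => a j.castSucc.rev).prod
  comm : a 3 * a 0 = a 0 * a 3

variable {M : Type*} [Monoid M] {a : Fin 4 → M}

namespace ElevenCellRel

theorem sq (h : ElevenCellRel a) : a 3 * a 3 = 1 := by
  simpa using h.vertex [0, 0] [] (by decide +kernel)

theorem comm_one (h : ElevenCellRel a) : a 3 * a 1 = a 1 * a 3 := by
  simpa using h.vertex [0, 2] [2, 0] (by decide +kernel)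

theorem braid (h : ElevenCellRel a) : a 3 * a 2 * a 3 = a 2 * a 3 * a 2 := by
  simpa [mul_assoc] using h.vertex [0, 1, 0] [1, 0, 1] (by decide +kernel)

theorem long (h : ElevenCellRel a) : a 3 * (a 2 * a 1 * a 2) * a 3 =
    a 1 * a 2 * a 1 * a 2 * a 3 * (a 2 * a 1 * a 2 * a 1 * a 2) := by
  simpa [mul_assoc] using
    h.vertex [0, 1, 2, 1, 0] [2, 1, 2, 1, 0, 1, 2, 1, 2, 1] (by decide +kernel)

theorem commute_shortWord (h : ElevenCellRel a) {d : List (Fin 3)} (hd : d ∈ shortWords) :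
    Commute (a 3) (d.map fun j => a j.castSucc).prod := by
  have hd' : ∀ j ∈ d, j ≠ 2 := (by decide : ∀ d ∈ shortWords, ∀ j ∈ d, j ≠ 2) d hd
  refine Commute.list_prod_right _ _ fun x hx => ?_
  obtain ⟨j, hj, rfl⟩ := List.mem_map.1 hx
  have := hd' j hj
  fin_cases j
  · exact h.comm
  · exact h.comm_one
  · contradiction

theorem conj_middleWord (h : ElevenCellRel a) {x : List (Fin 3)} (hx : x ∈ middleWords) :
    ∃ p : List (Fin 3), a 3 * (x.map fun j => a j.castSucc).prod * a 3 =
      (p.map fun j => a j.castSucc).prod ∨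
    ∃ q : List (Fin 3), a 3 * (x.map fun j => a j.castSucc).prod * a 3 =
      (p.map fun j => a j.castSucc).prod * a 3 * (q.map fun j => a j.castSucc).prod := by
  simp only [middleWords, List.mem_cons, List.not_mem_nil, or_false] at hx
  rcases hx with rfl | rfl | rfl
  · exact ⟨[], .inl (by simpa using h.sq)⟩
  · exact ⟨[2], .inr ⟨[2], by simpa [mul_assoc] using h.braid⟩⟩
  · exact ⟨[1, 2, 1, 2], .inr ⟨[2, 1, 2, 1, 2], by simpa [mul_assoc] using h.long⟩⟩

theorem conj_word (h : ElevenCellRel a) (u : List (Fin 3)) :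
    ∃ p : List (Fin 3), a 3 * (u.map fun j => a j.castSucc).prod * a 3 =
      (p.map fun j => a j.castSucc).prod ∨
    ∃ q : List (Fin 3), a 3 * (u.map fun j => a j.castSucc).prod * a 3 =
      (p.map fun j => a j.castSucc).prod * a 3 * (q.map fun j => a j.castSucc).prod := by
  obtain ⟨d, hd, x, hx, d', hd', hw⟩ := exists_word (act refl u 0)
  rw [← h.facet _ _ hw]
  have key : a 3 * ((d ++ x ++ d').map fun j => a j.castSucc).prod * a 3 =
      (d.map fun j => a j.castSucc).prod * (a 3 * (x.map fun j => a j.castSucc).prod * a 3) *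
        (d'.map fun j => a j.castSucc).prod := by
    have h1 := (h.commute_shortWord hd).eq
    have h2 := (h.commute_shortWord hd').eq
    simp only [List.map_append, List.prod_append, mul_assoc] at *
    rw [← h2, ← mul_assoc, h1, mul_assoc]
  obtain ⟨p, hp | ⟨q, hq⟩⟩ := h.conj_middleWord hx
  · refine ⟨d ++ p ++ d', .inl ?_⟩
    rw [key, hp]
    simp [mul_assoc]
  · refine ⟨d ++ p, .inr ⟨q ++ d', ?_⟩⟩
    rw [key, hq]
    simp [mul_assoc]

/-- Every word in the generators is a word in `a 0`, `a 1`, `a 2`, or the product of two such words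
with `a 3` in between. -/
theorem word_eq (h : ElevenCellRel a) (w : List (Fin 4)) :
    ∃ u : List (Fin 3), (w.map a).prod = (u.map fun j => a j.castSucc).prod ∨
    ∃ v : List (Fin 3), (w.map a).prod =
      (u.map fun j => a j.castSucc).prod * a 3 * (v.map fun j => a j.castSucc).prod := by
  induction w with
  | nil => exact ⟨[], .inl rfl⟩
  | cons i w ih =>
    rw [List.map_cons, List.prod_cons]
    induction i using Fin.lastCases with
    | last =>
      change ∃ u : List (Fin 3), a 3 * _ = _ ∨ ∃ v : List (Fin 3), a 3 * _ = _
      obtain ⟨u, hu | ⟨v, hv⟩⟩ := ih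
      · exact ⟨[], .inr ⟨u, by simp [hu]⟩⟩
      · rw [hv, ← mul_assoc, ← mul_assoc]
        obtain ⟨p, hp | ⟨q, hq⟩⟩ := h.conj_word u
        · exact ⟨p ++ v, .inl (by simp [hp])⟩
        · exact ⟨p, .inr ⟨q ++ v, by simp [hq, mul_assoc]⟩⟩
    | cast j =>
      obtain ⟨u, hu | ⟨v, hv⟩⟩ := ih
      · exact ⟨j :: u, .inl (by simp [hu])⟩
      · exact ⟨j :: u, .inr ⟨v, by simp [hv, mul_assoc]⟩⟩

end ElevenCellRel

end DoubleCoset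

/-! ### Reflections of flags -/

namespace APolytope

open FlagSeq HemiIcosa

theorem graded (P : APolytope.{u} 4) : Graded P.rank where
  strictMono := P.rank_strictMono
  mem := P.rank_mem
  flag := P.flag_ranks

variable {P : APolytope.{u} 4}

/-- The position in a flag of its face of rank `j`. -/
abbrev pos (j : Fin 4) : Fin 6 := j.castSucc.succ

theorem face_zero (f : FlagSeq P.rank) : f.face 0 = ⊥ :=
  (eq_bot_or_bot_lt _).resolve_right fun h => by
    simpa [P.rank_bot, f.rank_face] using P.rank_strictMono h

theorem face_five (f : FlagSeq P.rank) : f.face 5 = ⊤ :=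
  (eq_top_or_lt_top _).resolve_right fun h => by
    simpa [P.rank_top, f.rank_face] using P.rank_strictMono h

theorem exists_pos_or (i : Fin 6) : i = 0 ∨ i = 5 ∨ ∃ j, i = pos j := by
  decide +revert

theorem ext_pos {f g : FlagSeq P.rank} (h : ∀ j, f.face (pos j) = g.face (pos j)) : f = g :=
  FlagSeq.ext <| funext fun i => by
    rcases exists_pos_or i with rfl | rfl | ⟨j, rfl⟩
    · rw [face_zero, face_zero]
    · rw [face_five, face_five]
    · exact h j

theorem existsUnique_adj (j : Fin 4) (f : FlagSeq P.rank) : ∃! g, Adj (pos j) f g := by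
  have hlt : j.castSucc.castSucc < pos j := Fin.castSucc_lt_succ
  have hgt : pos j < j.succ.succ := by simp [pos, Fin.succ_lt_succ_iff]
  have hrank : P.rank (f.face j.succ.succ) = P.rank (f.face j.castSucc.castSucc) + 2 := by
    rw [f.rank_face, f.rank_face]
    simp only [Fin.val_succ, Fin.val_castSucc]
    omega
  obtain ⟨H₁, H₂, hne, hH⟩ := P.diamond _ _ (f.strictMono (hlt.trans hgt)) hrank
  have hbetween {g : FlagSeq P.rank} (hg : ∀ i, i ≠ pos j → f.face i = g.face i) :
      g.face (pos j) = H₁ ∨ g.face (pos j) = H₂ := by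
    rw [← hH, hg _ hlt.ne, hg _ hgt.ne']
    exact ⟨g.strictMono hlt, g.strictMono hgt⟩
  obtain ⟨H, hHne, hHF, hHG, hHu⟩ : ∃ H, f.face (pos j) ≠ H ∧ f.face j.castSucc.castSucc < H ∧
      H < f.face j.succ.succ ∧ ∀ H', H' ≠ f.face (pos j) → H' = H₁ ∨ H' = H₂ → H' = H := by
    rcases hbetween fun _ _ => rfl with h | h
    · exact ⟨H₂, h ▸ hne, ((hH _).2 (.inr rfl)).1, ((hH _).2 (.inr rfl)).2,
        fun H' h1 h2 => h2.resolve_left (h ▸ h1)⟩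
    · exact ⟨H₁, h ▸ hne.symm, ((hH _).2 (.inl rfl)).1, ((hH _).2 (.inl rfl)).2,
        fun H' h1 h2 => h2.resolve_right (h ▸ h1)⟩
  have hHrank : P.rank H = (pos j : ℕ) - 1 := by
    have h1 := P.rank_strictMono hHF
    have h2 := P.rank_strictMono hHG
    rw [f.rank_face] at h1 h2
    simp only [Fin.val_succ, Fin.val_castSucc] at *
    omega
  obtain ⟨g, hg, hgp, -⟩ := exists_replace P.graded f hHrank hHrank le_rfl
    (fun i hi => (f.strictMono.monotone (Nat.le_of_lt_succ hi)).trans hHF.le)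
    fun i hi => hHG.le.trans (f.strictMono.monotone (Nat.succ_le_of_lt hi))
  have hadj : Adj (pos j) f g := ⟨hgp ▸ hHne, fun i hi => (hg i (lt_or_gt_of_ne hi)).symm⟩
  refine ⟨g, hadj, fun g' hg' => FlagSeq.ext (funext fun i => ?_)⟩
  by_cases hi : i = pos j
  · rw [hi, hgp]
    exact hHu _ hg'.1.symm (hbetween hg'.2)
  · rw [← hg'.2 i hi, hadj.2 i hi]

variable (P) in
/-- The flag that differs from a given one exactly in the face of rank `j`. -/
noncomputable def reflect (j : Fin 4) (f : FlagSeq P.rank) : FlagSeq P.rank :=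
  (existsUnique_adj j f).choose

theorem adj_reflect (j : Fin 4) (f : FlagSeq P.rank) : Adj (pos j) f (P.reflect j f) :=
  (existsUnique_adj j f).choose_spec.1

theorem eq_reflect {j : Fin 4} {f g : FlagSeq P.rank} (h : Adj (pos j) f g) : g = P.reflect j f :=
  (existsUnique_adj j f).unique h (adj_reflect j f)

theorem reflect_reflect (j : Fin 4) (f : FlagSeq P.rank) : P.reflect j (P.reflect j f) = f :=
  (eq_reflect (adj_reflect j f).symm).symm

theorem reflect_face_of_ne {j : Fin 4} {i : Fin 6} (h : i ≠ pos j) (f : FlagSeq P.rank) :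
    (P.reflect j f).face i = f.face i :=
  ((adj_reflect j f).2 i h).symm

theorem reflect_comm (f : FlagSeq P.rank) :
    P.reflect 3 (P.reflect 0 f) = P.reflect 0 (P.reflect 3 f) := by
  obtain ⟨h, hle, hge⟩ := exists_mix (P.reflect 0 f) (P.reflect 3 f) (k := 2) <| by
    rw [reflect_face_of_ne (by decide), reflect_face_of_ne (by decide)]
  have key (i : Fin 6) : i ≤ 2 ∧ i ≠ 4 ∨ 2 ≤ i ∧ i ≠ 1 := by decide +revert
  have h3 : h = P.reflect 3 (P.reflect 0 f) := by
    refine eq_reflect ⟨?_, fun i hi => ?_⟩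
    · rw [hge _ (by decide), reflect_face_of_ne (by decide)]
      exact (adj_reflect 3 f).1
    · rcases key i with hi' | hi'
      · rw [hle i hi'.1]
      · rw [hge i hi'.1, reflect_face_of_ne hi, reflect_face_of_ne hi'.2]
  have h0 : h = P.reflect 0 (P.reflect 3 f) := by
    refine eq_reflect ⟨?_, fun i hi => ?_⟩
    · rw [hle _ (by decide), reflect_face_of_ne (by decide)]
      exact (adj_reflect 0 f).1
    · rcases key i with hi' | hi'
      · rw [hle i hi'.1, reflect_face_of_ne hi, reflect_face_of_ne hi'.2]
      · rw [hge i hi'.1]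
  exact h3.symm.trans h0

theorem act_reflect_reverse (w : List (Fin 4)) (f : FlagSeq P.rank) :
    act P.reflect w.reverse (act P.reflect w f) = f := by
  induction w generalizing f with
  | nil => rfl
  | cons j w ih =>
    rw [List.reverse_cons, act_append]
    exact (congrArg _ (reflect_reflect j _)).trans (ih f)

theorem act_reflect_face {i : Fin 6} {w : List (Fin 4)} (hw : ∀ j ∈ w, pos j ≠ i)
    (f : FlagSeq P.rank) : (act P.reflect w f).face i = f.face i := by
  induction w with
  | nil => rfl
  | cons j w ih =>
    rw [List.forall_mem_cons] at hw
    exact (reflect_face_of_ne hw.1.symm _).trans (ih hw.2)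

theorem exists_act_reflect (f g : FlagSeq P.rank) :
    ∃ w : List (Fin 4), (∀ j ∈ w, f.face (pos j) ≠ g.face (pos j)) ∧ act P.reflect w f = g := by
  suffices ∀ I h, Conn I f h → ∃ w : List (Fin 4), (∀ j ∈ w, pos j ∈ I) ∧ act P.reflect w f = h from
    this _ g (conn_of_connected P.graded
      (P.connected _ _ (f.isMaxChain P.graded) (g.isMaxChain P.graded)))
  intro I h hh
  induction hh with
  | refl => exact ⟨[], by simp, rfl⟩
  | tail _ hstep ih =>
    obtain ⟨w, hw, rfl⟩ := ih
    obtain ⟨i, hi, hadj⟩ := hstep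
    rcases exists_pos_or i with rfl | rfl | ⟨j, rfl⟩
    · exact absurd (by rw [face_zero, face_zero]) hadj.1
    · exact absurd (by rw [face_five, face_five]) hadj.1
    · exact ⟨j :: w, List.forall_mem_cons.2 ⟨hi, hw⟩, (eq_reflect hadj).symm⟩

theorem exists_face_eq_of_le {x y : P.α} (hxy : x ≤ y) :
    ∃ (f : FlagSeq P.rank) (i j : Fin 6), f.face i = x ∧ f.face j = y := by
  obtain ⟨f, hf⟩ := exists_of_isChain P.graded (IsChain.pair hxy)
  obtain ⟨i, hi⟩ := hf (Set.mem_insert x {y})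
  obtain ⟨j, hj⟩ := hf (Set.mem_insert_of_mem x rfl)
  exact ⟨f, i, j, hi, hj⟩

end APolytope

/-! ### Coordinates for the flags in a facet or at a vertex -/

namespace APolytope

open FlagSeq HemiIcosa

variable {P : APolytope.{u} 4}

variable (P) in
/-- The flags with a given face at position `c` can be identified with the flags of the
hemi-icosahedron, such that the reflection in `emb j` becomes that in `j`. -/
def HasCoord (c : Fin 6) (emb : Fin 3 → Fin 4) : Prop :=
  ∀ f : FlagSeq P.rank, ∃ θ : FlagSeq P.rank → Fin 60, ∀ g, g.face c = f.face c →
    (∀ j, θ (P.reflect (emb j) g) = HemiIcosa.refl j (θ g)) ∧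
    ∀ h, h.face c = f.face c → θ g = θ h → g = h

namespace HasCoord

variable {c : Fin 6} {emb : Fin 3 → Fin 4}

theorem act_coord (hc : ∀ j, pos (emb j) ≠ c) {f : FlagSeq P.rank} {θ : FlagSeq P.rank → Fin 60}
    (hθ : ∀ g, g.face c = f.face c → ∀ j, θ (P.reflect (emb j) g) = HemiIcosa.refl j (θ g))
    (u : List (Fin 3)) :
    (act P.reflect (u.map emb) f).face c = f.face c ∧
      θ (act P.reflect (u.map emb) f) = act HemiIcosa.refl u (θ f) := by
  have hface (u : List (Fin 3)) : (act P.reflect (u.map emb) f).face c = f.face c :=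
    act_reflect_face (by simpa using fun j _ => hc j) f
  refine ⟨hface u, ?_⟩
  induction u with
  | nil => rfl
  | cons j u ih => exact (hθ _ (hface u) j).trans (congrArg _ ih)

theorem act_eq (h : P.HasCoord c emb) (hc : ∀ j, pos (emb j) ≠ c) {u v : List (Fin 3)}
    (huv : act HemiIcosa.refl u 0 = act HemiIcosa.refl v 0) (f : FlagSeq P.rank) :
    act P.reflect (u.map emb) f = act P.reflect (v.map emb) f := by
  obtain ⟨θ, hθ⟩ := h f
  have hu := act_coord hc (fun g hg => (hθ g hg).1) u
  have hv := act_coord hc (fun g hg => (hθ g hg).1) v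
  exact (hθ _ hu.1).2 _ hv.1 (hu.2.trans ((act_congr huv _).trans hv.2.symm))

theorem act_zero (h : P.HasCoord c emb) (hc : ∀ j, pos (emb j) ≠ c) {u : List (Fin 3)}
    {f : FlagSeq P.rank} (hu : act P.reflect (u.map emb) f = f) :
    act HemiIcosa.refl u 0 = 0 := by
  obtain ⟨θ, hθ⟩ := h f
  have := (act_coord hc (fun g hg => (hθ g hg).1) u).2
  rw [hu] at this
  exact act_zero_of_act_eq this.symm

theorem card_flags (h : P.HasCoord c emb) (hc : ∀ j, pos (emb j) ≠ c) (f : FlagSeq P.rank) :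
    Nonempty ({g : FlagSeq P.rank // g.face c = f.face c} ≃ Fin 60) := by
  obtain ⟨θ, hθ⟩ := h f
  refine ⟨Equiv.ofBijective (fun g => θ g.1)
    ⟨fun g g' hg => Subtype.ext ((hθ g.1 g.2).2 g'.1 g'.2 hg), fun t => ?_⟩⟩
  obtain ⟨u, hu⟩ := exists_word_zero (θ f)
  obtain ⟨w, rfl⟩ := exists_word_zero t
  have key := act_coord hc (fun g hg => (hθ g hg).1) (w ++ u.reverse)
  refine ⟨⟨_, key.1⟩, key.2.trans ?_⟩
  rw [act_append, ← hu]
  have := act_act_reverse u.reverse 0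
  rw [List.reverse_reverse] at this
  rw [this]

end HasCoord

theorem hasCoord_of_label {c : Fin 6} {emb : Fin 3 → Fin 4} {ι : Fin 5 → Fin 6}
    (hι : ι.Injective) (hemb : ∀ j, ι j.succ.castSucc = pos (emb j))
    (hc : ∀ j, pos (emb j) ≠ c) (hc' : ∀ k, pos k = c ∨ ∃ j, k = emb j)
    (hlab : ∀ x : P.α, P.rank x = (c : ℕ) - 1 → ∃ lab : P.α → Fin 33,
      ∀ f : FlagSeq P.rank, f.face c = x → ∀ g : FlagSeq P.rank, g.face c = x →
        (∀ i : Fin 4, HemiIcosa.Sub (lab (f.face (ι i.castSucc))) (lab (f.face (ι i.succ)))) ∧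
        ∀ i j, lab (f.face (ι i)) = lab (g.face (ι j)) → f.face (ι i) = g.face (ι j)) :
    P.HasCoord c emb := by
  intro f
  obtain ⟨lab, hlab⟩ := hlab (f.face c) (f.rank_face c)
  have hne (g : FlagSeq P.rank) (hg : g.face c = f.face c) (i : Fin 4) :
      lab (g.face (ι i.castSucc)) ≠ lab (g.face (ι i.succ)) := fun h =>
    (Fin.castSucc_lt_succ (i := i)).ne (hι (face_inj ((hlab g hg g hg).2 _ _ h)))
  have hex (g : FlagSeq P.rank) : ∃ t, g.face c = f.face c →
      ∀ j : Fin 3, face t j = lab (g.face (pos (emb j))) := by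
    by_cases hg : g.face c = f.face c
    · have hs := (hlab g hg g hg).1
      have hn := hne g hg
      obtain ⟨t, h0, h1, h2⟩ := face_eq_of_chain _ _ (hs 0) (hn 0) _ (hs 1) (hn 1) _ (hs 2) (hn 2)
        _ (hs 3) (hn 3)
      refine ⟨t, fun _ j => ?_⟩
      rw [← hemb]
      fin_cases j
      · exact h0
      · exact h1
      · exact h2
    · exact ⟨0, fun h => absurd h hg⟩
  choose θ hθ using hex
  have hinj {g h : FlagSeq P.rank} (hg : g.face c = f.face c) (hh : h.face c = f.face c)
      (j : Fin 3) : face (θ g) j = face (θ h) j ↔ g.face (pos (emb j)) = h.face (pos (emb j)) := by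
    rw [hθ g hg, hθ h hh]
    refine ⟨fun he => ?_, congrArg lab⟩
    rw [← hemb] at he ⊢
    exact (hlab g hg h hh).2 _ _ he
  refine ⟨θ, fun g hg => ⟨fun j => ?_, fun h hh he => ext_pos fun k => ?_⟩⟩
  · have hh := (reflect_face_of_ne (hc j).symm g).trans hg
    refine refl_eq j _ _ (fun he => (adj_reflect (emb j) g).1 ((hinj hg hh j).1 he)) fun i hi => ?_
    refine (hinj hg hh i).2 ((adj_reflect (emb j) g).2 _ fun he => hi ?_)
    rw [← hemb, ← hemb] at he
    exact Fin.succ_injective _ (Fin.castSucc_injective _ (hι he))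
  · rcases hc' k with rfl | ⟨j, rfl⟩
    · exact hg.trans hh.symm
    · exact (hinj hg hh j).1 (by rw [he])

theorem FacetsAre.hasCoord (h : P.FacetsAre HemiIcosaPoset) : P.HasCoord 4 Fin.castSucc := by
  refine hasCoord_of_label (ι := Fin.castSucc) (Fin.castSucc_injective _) (by decide) (by decide)
    (by decide) fun x hx => ?_
  obtain ⟨e⟩ := h x hx
  classical
  have hle (f : FlagSeq P.rank) (hf : f.face 4 = x) (i : Fin 5) : f.face i.castSucc ≤ x :=
    hf ▸ f.strictMono.monotone (Fin.le_def.2 (Nat.le_of_lt_succ i.isLt))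
  refine ⟨fun y => if hy : y ≤ x then label (e ⟨y, hy⟩).1 else 0, fun f hf g hg =>
    ⟨fun i => ?_, fun i j hij => ?_⟩⟩
  · simp only [dif_pos (hle f hf _), ← le_iff, e.le_iff_le]
    exact (f.face_lt _).le
  · simp only [dif_pos (hle f hf _), dif_pos (hle g hg _)] at hij
    exact congrArg Subtype.val (e.injective (label_injective hij))

theorem VertexFiguresAre.hasCoord (h : P.VertexFiguresAre HemiDodecaPoset) :
    P.HasCoord 1 fun j => j.castSucc.rev := by
  refine hasCoord_of_label (ι := fun i => i.castSucc.rev) ?_ (by decide) (by decide)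
    (by decide) fun x hx => ?_
  · exact Fin.rev_injective.comp (Fin.castSucc_injective _)
  obtain ⟨e⟩ := h x hx
  classical
  have hle (f : FlagSeq P.rank) (hf : f.face 1 = x) (i : Fin 5) : x ≤ f.face i.castSucc.rev :=
    hf ▸ f.strictMono.monotone (by decide +revert)
  refine ⟨fun y => if hy : x ≤ y then label (e ⟨y, hy⟩).ofDual.1 else 0, fun f hf g hg =>
    ⟨fun i => ?_, fun i j hij => ?_⟩⟩
  · simp only [dif_pos (hle f hf _), ← le_iff, OrderDual.ofDual_le_ofDual, e.le_iff_le]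
    exact f.strictMono.monotone (by decide +revert)
  · simp only [dif_pos (hle f hf _), dif_pos (hle g hg _)] at hij
    exact congrArg Subtype.val (e.injective (OrderDual.ofDual.injective (label_injective hij)))

end APolytope

/-! ### Uniqueness and automorphisms -/

namespace APolytope

open FlagSeq HemiIcosa

variable {P : APolytope.{u} 4} {Q : APolytope.{v} 4}

variable (P) in
/-- The flags in a facet or at a vertex can be identified with those of the hemi-icosahedron. -/
structure IsElevenCell : Prop where
  facet : P.HasCoord 4 Fin.castSucc
  vertex : P.HasCoord 1 fun j => j.castSucc.rev

variable (P Q) in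
/-- The simultaneous reflection of flags of two polytopes. -/
noncomputable def reflectPair (j : Fin 4) :
    Function.End (FlagSeq P.rank) × Function.End (FlagSeq Q.rank) :=
  (P.reflect j, Q.reflect j)

theorem prod_reflectPair (w : List (Fin 4)) :
    (w.map (reflectPair P Q)).prod = (act P.reflect w, act Q.reflect w) := by
  induction w with
  | nil => rfl
  | cons j w ih => rw [List.map_cons, List.prod_cons, ih]; rfl

theorem IsElevenCell.rel (hP : P.IsElevenCell) (hQ : Q.IsElevenCell) :
    ElevenCellRel (reflectPair P Q) where
  facet u v huv := by
    have h := prod_reflectPair (P := P) (Q := Q)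
    have hu := h (u.map Fin.castSucc)
    have hv := h (v.map Fin.castSucc)
    rw [List.map_map] at hu hv
    refine hu.trans (Eq.trans ?_ hv.symm)
    exact Prod.ext (funext fun f => hP.facet.act_eq (by decide) huv f)
      (funext fun f => hQ.facet.act_eq (by decide) huv f)
  vertex u v huv := by
    have h := prod_reflectPair (P := P) (Q := Q)
    have hu := h (u.map fun j => j.castSucc.rev)
    have hv := h (v.map fun j => j.castSucc.rev)
    rw [List.map_map] at hu hv
    refine hu.trans (Eq.trans ?_ hv.symm)
    exact Prod.ext (funext fun f => hP.vertex.act_eq (by decide) huv f)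
      (funext fun f => hQ.vertex.act_eq (by decide) huv f)
  comm := Prod.ext (funext reflect_comm) (funext reflect_comm)

namespace IsElevenCell

/-- A word in the reflections that fixes a flag of one polytope fixes all flags of the other. -/
theorem act_eq_self (hP : P.IsElevenCell) (hQ : Q.IsElevenCell) {w : List (Fin 4)}
    {f : FlagSeq P.rank} (hw : act P.reflect w f = f) (g : FlagSeq Q.rank) :
    act Q.reflect w g = g := by
  have hne : ∀ j : Fin 3, pos j.castSucc ≠ 4 := by decide
  have hface (u : List (Fin 3)) (f : FlagSeq P.rank) :
      (act P.reflect (u.map Fin.castSucc) f).face 4 = f.face 4 :=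
    act_reflect_face (by simpa using fun j _ => hne j) f
  obtain ⟨u, hu | ⟨v, hv⟩⟩ := (hP.rel hQ).word_eq w
  · have h := prod_reflectPair (P := P) (Q := Q) (u.map Fin.castSucc)
    rw [List.map_map] at h
    rw [prod_reflectPair] at hu
    replace hu := hu.trans h
    have h1 : act P.reflect w f = act P.reflect (u.map Fin.castSucc) f :=
      congrFun (congrArg Prod.fst hu) f
    have h2 : act Q.reflect w g = act Q.reflect (u.map Fin.castSucc) g :=
      congrFun (congrArg Prod.snd hu) g
    rw [h2]
    exact hQ.facet.act_eq hne (v := []) (hP.facet.act_zero hne (h1.symm.trans hw)) g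
  · have hu := prod_reflectPair (P := P) (Q := Q) (u.map Fin.castSucc)
    have hv' := prod_reflectPair (P := P) (Q := Q) (v.map Fin.castSucc)
    rw [List.map_map] at hu hv'
    rw [prod_reflectPair] at hv
    replace hv := hv.trans (congrArg₂ (fun x y => x * reflectPair P Q 3 * y) hu hv')
    have h1 : act P.reflect w f = act P.reflect (u.map Fin.castSucc)
        (P.reflect 3 (act P.reflect (v.map Fin.castSucc) f)) :=
      congrFun (congrArg Prod.fst hv) f
    have h2 := congrArg (fun f => f.face 4) (h1.symm.trans hw)
    simp only [hface] at h2
    exact absurd ((hface v f).trans h2.symm) (adj_reflect 3 _).1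

theorem act_eq_act (hP : P.IsElevenCell) (hQ : Q.IsElevenCell) {w w' : List (Fin 4)}
    {f : FlagSeq P.rank} (hw : act P.reflect w f = act P.reflect w' f) (g : FlagSeq Q.rank) :
    act Q.reflect w g = act Q.reflect w' g := by
  have h := hP.act_eq_self hQ (w := w.reverse ++ w') (f := f)
    (by rw [act_append, ← hw, act_reflect_reverse]) g
  rw [act_append] at h
  have h' := act_reflect_reverse w.reverse (act Q.reflect w' g)
  rw [h, List.reverse_reverse] at h'
  exact h'

theorem exists_flagMap (hP : P.IsElevenCell) (hQ : Q.IsElevenCell) (f : FlagSeq P.rank)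
    (g : FlagSeq Q.rank) : ∃ φ : FlagSeq P.rank → FlagSeq Q.rank,
      φ f = g ∧ ∀ j h, φ (P.reflect j h) = Q.reflect j (φ h) := by
  choose w hw using fun h => (exists_act_reflect f h).imp fun _ h => h.2
  refine ⟨fun h => act Q.reflect (w h) g, ?_, fun j h => ?_⟩
  · exact hP.act_eq_act hQ (w' := []) (hw f) g
  · refine hP.act_eq_act hQ (w' := j :: w h) (f := f) ?_ g
    rw [hw]
    exact (congrArg _ (hw h)).symm

end IsElevenCell

section FlagMap

variable {φ : FlagSeq P.rank → FlagSeq Q.rank}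

theorem flagMap_act (hφ : ∀ j h, φ (P.reflect j h) = Q.reflect j (φ h)) (w : List (Fin 4))
    (f : FlagSeq P.rank) : φ (act P.reflect w f) = act Q.reflect w (φ f) := by
  induction w with
  | nil => rfl
  | cons j w ih => exact (hφ j _).trans (congrArg _ ih)

theorem flagMap_face (hφ : ∀ j h, φ (P.reflect j h) = Q.reflect j (φ h)) {f g : FlagSeq P.rank}
    {i : Fin 6} (h : f.face i = g.face i) : (φ f).face i = (φ g).face i := by
  obtain ⟨w, hw, rfl⟩ := exists_act_reflect f g
  rw [flagMap_act hφ, act_reflect_face]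
  rintro j hj rfl
  exact hw j hj h

theorem exists_faceMap (hφ : ∀ j h, φ (P.reflect j h) = Q.reflect j (φ h)) :
    ∃ m : P.α → Q.α, Monotone m ∧ ∀ f i, m (f.face i) = (φ f).face i := by
  choose F I J hI _ using fun x : P.α => exists_face_eq_of_le (le_refl x)
  have hm (f : FlagSeq P.rank) (i : Fin 6) : (φ (F (f.face i))).face (I (f.face i)) =
      (φ f).face i := by
    have h := hI (f.face i)
    have hi := face_inj h
    rw [hi] at h ⊢
    exact flagMap_face hφ h
  refine ⟨fun x => (φ (F x)).face (I x), fun x y hxy => ?_, hm⟩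
  obtain ⟨f, i, j, rfl, rfl⟩ := exists_face_eq_of_le hxy
  simp only [hm]
  exact (φ f).strictMono.monotone (f.strictMono.le_iff_le.1 hxy)

end FlagMap

namespace IsElevenCell

theorem exists_orderIso (hP : P.IsElevenCell) (hQ : Q.IsElevenCell) (f : FlagSeq P.rank)
    (g : FlagSeq Q.rank) : ∃ e : P.α ≃o Q.α, ∀ i, e (f.face i) = g.face i := by
  obtain ⟨φ, hφf, hφ⟩ := hP.exists_flagMap hQ f g
  obtain ⟨ψ, hψg, hψ⟩ := hQ.exists_flagMap hP g f
  obtain ⟨m, hm, hmφ⟩ := exists_faceMap hφ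
  obtain ⟨n, hn, hnψ⟩ := exists_faceMap hψ
  have hnm (x : P.α) : n (m x) = x := by
    obtain ⟨h, i, -, rfl, -⟩ := exists_face_eq_of_le (le_refl x)
    obtain ⟨w, -, rfl⟩ := exists_act_reflect f h
    rw [hmφ, hnψ, flagMap_act hφ, flagMap_act hψ, hφf, hψg]
  have hmn (x : Q.α) : m (n x) = x := by
    obtain ⟨h, i, -, rfl, -⟩ := exists_face_eq_of_le (le_refl x)
    obtain ⟨w, -, rfl⟩ := exists_act_reflect g h
    rw [hnψ, hmφ, flagMap_act hψ, flagMap_act hφ, hψg, hφf]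
  exact ⟨(⟨m, n, hnm, hmn⟩ : P.α ≃ Q.α).toOrderIso hm hn, fun i => (hmφ f i).trans (by rw [hφf])⟩

end IsElevenCell

variable (P) in
theorem nonempty_flag : Nonempty (FlagSeq P.rank) :=
  let ⟨f, _⟩ := exists_face_eq_of_le (le_refl (⊥ : P.α))
  ⟨f⟩

/-- The image of a flag under an isomorphism. -/
def mapFlag (e : P.α ≃o Q.α) (f : FlagSeq P.rank) : FlagSeq Q.rank where
  face i := e (f.face i)
  face_lt i := e.strictMono (f.face_lt i)
  rank_face i := by
    have h (i : Fin 5) := Q.rank_strictMono (e.strictMono (f.face_lt i))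
    have h0 := (Q.rank_mem (e (f.face 0))).1
    have h5 := (Q.rank_mem (e (f.face 5))).2
    have h01 := h 0
    have h12 := h 1
    have h23 := h 2
    have h34 := h 3
    have h45 := h 4
    simp only [Fin.isValue, Fin.reduceCastSucc, Fin.reduceSucc] at *
    fin_cases i <;> simp <;> omega

theorem rank_orderIso (e : P.α ≃o Q.α) (x : P.α) : Q.rank (e x) = P.rank x := by
  obtain ⟨f, i, -, rfl, -⟩ := exists_face_eq_of_le (le_refl x)
  exact ((mapFlag e f).rank_face i).trans (f.rank_face i).symm

theorem mapFlag_reflect (e : P.α ≃o Q.α) (j : Fin 4) (f : FlagSeq P.rank) :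
    mapFlag e (P.reflect j f) = Q.reflect j (mapFlag e f) :=
  eq_reflect ⟨fun h => (adj_reflect j f).1 (e.injective h),
    fun i hi => congrArg e ((adj_reflect j f).2 i hi)⟩

theorem mapFlag_injective (f : FlagSeq P.rank) :
    Function.Injective fun e : P.α ≃o Q.α => mapFlag e f := by
  refine fun e e' h => OrderIso.ext (funext fun x => ?_)
  obtain ⟨g, i, -, rfl, -⟩ := exists_face_eq_of_le (le_refl x)
  obtain ⟨w, -, rfl⟩ := exists_act_reflect f g
  change (mapFlag e _).face i = (mapFlag e' _).face i
  rw [flagMap_act (mapFlag_reflect e), flagMap_act (mapFlag_reflect e')]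
  exact congrArg (fun f => (act Q.reflect w f).face i) h

namespace IsElevenCell

theorem card_facets (hP : P.IsElevenCell) : Nat.card {F : P.α // P.rank F = 3} = 11 := by
  have hQ : ElevenCell.polytope.{u}.IsElevenCell :=
    ⟨ElevenCell.facetsAre.hasCoord, ElevenCell.vertexFiguresAre.hasCoord⟩
  obtain ⟨f⟩ := P.nonempty_flag
  obtain ⟨g⟩ := ElevenCell.polytope.{u}.nonempty_flag
  obtain ⟨e, -⟩ := hP.exists_orderIso hQ f g
  rw [← ElevenCell.card_facets.{u}]
  exact Nat.card_congr (e.toEquiv.subtypeEquiv fun x => by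
    change _ ↔ ElevenCell.polytope.rank (e x) = 3
    rw [rank_orderIso])

theorem card_flags (hP : P.IsElevenCell) : Nat.card (FlagSeq P.rank) = 660 := by
  let facet (g : FlagSeq P.rank) : {F : P.α // P.rank F = 3} :=
    ⟨g.face 4, (g.rank_face 4).trans (by decide)⟩
  have hfib (F : {F : P.α // P.rank F = 3}) : Nonempty ({g // facet g = F} ≃ Fin 60) := by
    obtain ⟨f, i, -, hi, -⟩ := exists_face_eq_of_le (le_refl F.1)
    have h4 : i = 4 := by
      have := f.rank_face i
      rw [hi, F.2] at this
      omega
    obtain ⟨e⟩ := hP.facet.card_flags (by decide) f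
    refine ⟨(Equiv.subtypeEquivRight fun g => ?_).trans e⟩
    rw [← h4, hi, h4, ← Subtype.val_inj]
  rw [Nat.card_congr ((Equiv.sigmaFiberEquiv facet).symm.trans
    ((Equiv.sigmaCongrRight fun F => (hfib F).some).trans (Equiv.sigmaEquivProd _ _))),
    Nat.card_prod, hP.card_facets, Nat.card_fin]

theorem card_automorphisms (hP : P.IsElevenCell) : Nat.card (P.α ≃o P.α) = 660 := by
  obtain ⟨f⟩ := P.nonempty_flag
  rw [← hP.card_flags]
  refine Nat.card_congr (Equiv.ofBijective _ ⟨mapFlag_injective f, fun g => ?_⟩)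
  obtain ⟨e, he⟩ := hP.exists_orderIso hP f g
  exact ⟨e, FlagSeq.ext (funext he)⟩

end IsElevenCell

end APolytope

/-- There exists a rank-4 abstract polytope all of whose facets are isomorphic to the
hemi-icosahedron `{3,5}₅` and all of whose vertex figures are isomorphic to the
hemidodecahedron `{5,3}₅` (the 11-cell); any two such polytopes are isomorphic; and any
such polytope has exactly 11 faces of rank 3 and its automorphism group has order 660. -/
theorem statement_4 :
    (∃ P : APolytope.{u} 4,
      P.FacetsAre HemiIcosaPoset ∧ P.VertexFiguresAre HemiDodecaPoset) ∧
    (∀ (P : APolytope.{u} 4) (Q : APolytope.{v} 4),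
      P.FacetsAre HemiIcosaPoset → P.VertexFiguresAre HemiDodecaPoset →
      Q.FacetsAre HemiIcosaPoset → Q.VertexFiguresAre HemiDodecaPoset → P.Iso Q) ∧
    (∀ P : APolytope.{u} 4,
      P.FacetsAre HemiIcosaPoset → P.VertexFiguresAre HemiDodecaPoset →
      Nat.card {F : P.α // P.rank F = 3} = 11 ∧ Nat.card (P.α ≃o P.α) = 660) := by
  refine ⟨⟨ElevenCell.polytope, ElevenCell.facetsAre, ElevenCell.vertexFiguresAre⟩,
    fun P Q hPF hPV hQF hQV => ?_, fun P hPF hPV => ?_⟩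
  · obtain ⟨f⟩ := P.nonempty_flag
    obtain ⟨g⟩ := Q.nonempty_flag
    have hP : P.IsElevenCell := ⟨hPF.hasCoord, hPV.hasCoord⟩
    have hQ : Q.IsElevenCell := ⟨hQF.hasCoord, hQV.hasCoord⟩
    obtain ⟨e, -⟩ := hP.exists_orderIso hQ f g
    exact ⟨e⟩
  · have hP : P.IsElevenCell := ⟨hPF.hasCoord, hPV.hasCoord⟩
    exact ⟨hP.card_facets, hP.card_automorphisms⟩
end
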